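/- Let k ≥ 2 be an integer and let ℓ = (l_1, …, l_m) with m ≥ 3 be the segment sequence of some tree. Then there exists a quasi-caterpillar Q with segment sequence ℓ such that SW_k(T) ≤ SW_k(Q) for every tree T with segment sequence ℓ; that is, among all trees with segment sequence ℓ, the Steiner k-Wiener index is maximized by a quasi-caterpillar. -/

import Mathlib

open SimpleGraph Finset

noncomputable def steinerDist {V : Type*} (G : SimpleGraph V) (S : Finset V) : ℕ :=
  sInf {n | ∃ H : G.Subgraph, H.Connected ∧ ↑S ⊆ H.verts ∧ H.edgeSet.ncard = n}

noncomputable def steinerWiener {V : Type*} [Fintype V] (G : SimpleGraph V) (k : ℕ) : ℕ :=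
  ∑ S ∈ Finset.powersetCard k (Finset.univ : Finset V), steinerDist G S

noncomputable def degN {V : Type*} (G : SimpleGraph V) (v : V) : ℕ := (G.neighborSet v).ncard

def IsLeafV {V : Type*} (G : SimpleGraph V) (v : V) : Prop := degN G v = 1

def IsBranchV {V : Type*} (G : SimpleGraph V) (v : V) : Prop := 3 ≤ degN G v

def IsSegment {V : Type*} (G : SimpleGraph V) (u v : V) : Prop :=
  u ≠ v ∧ (IsLeafV G u ∨ IsBranchV G u) ∧ (IsLeafV G v ∨ IsBranchV G v) ∧
    ∃ w : G.Walk u v, w.IsPath ∧ ∀ x ∈ w.support, x ≠ u → x ≠ v → degN G x = 2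

noncomputable def segmentMultiset {V : Type*} [Fintype V] (G : SimpleGraph V) : Multiset ℕ :=
  ((Set.toFinite {e : Sym2 V | ∃ u v, e = s(u, v) ∧ IsSegment G u v}).toFinset).val.map
    (Sym2.lift ⟨fun u v => G.dist u v, fun _ _ => SimpleGraph.dist_comm⟩)

/-- A graph is a path graph if it has a Hamiltonian path. -/
def IsPathGraph {V : Type*} (G : SimpleGraph V) : Prop :=
  ∃ (u v : V) (w : G.Walk u v), w.IsPath ∧ ∀ x, x ∈ w.support

/-- The set of vertices lying on pendant segments, other than branch-vertex endpoints. -/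
def pendantSegmentVertices {V : Type*} (G : SimpleGraph V) : Set V :=
  {x | ∃ (u v : V) (w : G.Walk u v), IsSegment G u v ∧ IsLeafV G u ∧ w.IsPath ∧
      (∀ y ∈ w.support, y ≠ u → y ≠ v → degN G y = 2) ∧ x ∈ w.support ∧ ¬ IsBranchV G x}

/-- A quasi-caterpillar: a tree such that deleting all vertices of its pendant segments other
than their branch-vertex endpoints results in a path. -/
def IsQuasiCaterpillar {V : Type*} [Fintype V] (G : SimpleGraph V) : Prop :=
  G.IsTree ∧ IsPathGraph (G.induce (pendantSegmentVertices G)ᶜ)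

/-- A backbone: a longest path containing all branch vertices. -/
def IsBackbone {V : Type*} (G : SimpleGraph V) {u v : V} (w : G.Walk u v) : Prop :=
  w.IsPath ∧ (∀ x, IsBranchV G x → x ∈ w.support) ∧
    ∀ (a b : V) (w' : G.Walk a b), w'.IsPath →
      (∀ x, IsBranchV G x → x ∈ w'.support) → w'.length ≤ w.length

section Cuts

open scoped Classical

variable {V : Type*} [Fintype V] {G : SimpleGraph V}

/-- `A` is a nonempty proper vertex set such that no edge other than `e` leaves it. -/
def IsCut (G : SimpleGraph V) (A : Finset V) (e : Sym2 V) : Prop :=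
  A.Nonempty ∧ A ≠ univ ∧ ∀ p q, p ∈ A → q ∉ A → G.Adj p q → s(p, q) = e

lemma eq_empty_or_univ_of_not_adj (hG : G.Connected) (D : Finset V)
    (h : ∀ p q, p ∈ D → q ∉ D → ¬ G.Adj p q) : D = ∅ ∨ D = univ := by
  by_contra! hD
  obtain ⟨⟨p, hp⟩, hD⟩ := hD
  obtain ⟨q, hq⟩ : ∃ q, q ∉ D := by
    by_contra! h'
    exact hD (Finset.eq_univ_of_forall h')
  obtain ⟨w⟩ := hG.preconnected p q
  obtain ⟨d, -, h1, h2⟩ := w.exists_boundary_dart (D : Set V) hp hq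
  exact h _ _ h1 h2 d.adj

lemma IsCut.exists_adj {A : Finset V} {e : Sym2 V} (hG : G.Connected) (h : IsCut G A e) :
    ∃ p q, p ∈ A ∧ q ∉ A ∧ G.Adj p q ∧ e = s(p, q) := by
  by_contra! hc
  rcases eq_empty_or_univ_of_not_adj hG A
    (fun p q hp hq hpq => hc p q hp hq hpq (h.2.2 p q hp hq hpq).symm) with h' | h'
  · exact h.1.ne_empty h'
  · exact h.2.1 h'

lemma IsCut.of_mem {A : Finset V} {e : Sym2 V} {a b : V} (ha : a ∈ A) (hb : b ∉ A)
    (h : ∀ p q, p ∈ A → q ∉ A → G.Adj p q → s(p, q) = e) : IsCut G A e :=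
  ⟨⟨a, ha⟩, fun h' => hb (h' ▸ Finset.mem_univ b), h⟩

lemma IsCut.exists_notMem {A : Finset V} {e : Sym2 V} (h : IsCut G A e) : ∃ x, x ∉ A := by
  by_contra! h'
  exact h.2.1 (Finset.eq_univ_of_forall h')

lemma IsCut.compl {A : Finset V} {e : Sym2 V} (h : IsCut G A e) : IsCut G Aᶜ e := by
  obtain ⟨x, hx⟩ := h.exists_notMem
  obtain ⟨y, hy⟩ := h.1
  refine IsCut.of_mem (a := x) (b := y) (by simpa) (by simpa) fun p q hp hq hpq => ?_
  rw [Sym2.eq_swap]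
  exact h.2.2 q p (by simpa using hq) (by simpa using hp) hpq.symm

lemma IsCut.mem_iff {A : Finset V} {e : Sym2 V} (h : IsCut G A e) {p q : V}
    (hpq : G.Adj p q) (hne : s(p, q) ≠ e) : p ∈ A ↔ q ∈ A := by
  have h1 := h.2.2 p q
  have h2 := h.2.2 q p
  rw [Sym2.eq_swap] at h2
  have := hpq.symm
  tauto

lemma IsCut.not_mem_iff (hG : G.Connected) {A : Finset V} {p q : V}
    (h : IsCut G A s(p, q)) : ¬ (p ∈ A ↔ q ∈ A) := by
  obtain ⟨a, b, ha, hb, hab, he⟩ := h.exists_adj hG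
  rw [Sym2.eq_iff] at he
  grind

lemma IsCut.eq_or_eq_compl (hG : G.Connected) {A B : Finset V} {e : Sym2 V}
    (hA : IsCut G A e) (hB : IsCut G B e) : A = B ∨ A = Bᶜ := by
  have key : ∀ p q, G.Adj p q → ((p ∈ A ↔ p ∈ B) ↔ (q ∈ A ↔ q ∈ B)) := by
    intro p q hpq
    by_cases he : s(p, q) = e
    · subst he
      have h1 := hA.not_mem_iff hG
      have h2 := hB.not_mem_iff hG
      tauto
    · rw [hA.mem_iff hpq he, hB.mem_iff hpq he]
  rcases eq_empty_or_univ_of_not_adj hG (univ.filter fun v => (v ∈ A ↔ v ∈ B)) (by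
    intro p q hp hq hpq
    have := key p q hpq
    simp only [Finset.mem_filter, Finset.mem_univ, true_and] at hp hq
    tauto) with h | h
  · right
    ext v
    have : v ∉ univ.filter fun v => (v ∈ A ↔ v ∈ B) := by simp [h]
    simp only [Finset.mem_filter, Finset.mem_univ, true_and] at this
    simp only [Finset.mem_compl]
    tauto
  · left
    ext v
    have : v ∈ univ.filter fun v => (v ∈ A ↔ v ∈ B) := by simp [h]
    simpa using this

/-- Two cuts of the same edge which both avoid a vertex coincide. -/
lemma IsCut.eq_of_notMem (hG : G.Connected) {A B : Finset V} {e : Sym2 V} {c : V}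
    (hA : IsCut G A e) (hB : IsCut G B e) (ha : c ∉ A) (hb : c ∉ B) : A = B := by
  rcases hA.eq_or_eq_compl hG hB with h | h
  · exact h
  · subst h
    simp at ha
    exact absurd ha hb

lemma exists_isCut_of_adj (hG : G.IsTree) {a b : V} (hab : G.Adj a b) :
    ∃ A, IsCut G A s(a, b) ∧ b ∈ A ∧ a ∉ A := by
  have hbr : G.IsBridge s(a, b) := isAcyclic_iff_forall_adj_isBridge.1 hG.2 hab
  rw [isBridge_iff] at hbr
  have hb : b ∈ univ.filter fun y => (G.deleteEdges {s(a, b)}).Reachable b y := by simp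
  have ha : a ∉ univ.filter fun y => (G.deleteEdges {s(a, b)}).Reachable b y := by
    simp only [Finset.mem_filter, Finset.mem_univ, true_and]
    exact fun h => hbr h.symm
  refine ⟨_, IsCut.of_mem hb ha ?_, hb, ha⟩
  intro p q hp hq hpq
  simp only [Finset.mem_filter, Finset.mem_univ, true_and] at hp hq
  by_contra hne
  refine hq (hp.trans (Adj.reachable ?_))
  simp only [deleteEdges_adj, Set.mem_singleton_iff]
  exact ⟨hpq, hne⟩

lemma exists_isCut_notMem (hG : G.IsTree) (c : V) {e : Sym2 V} (he : e ∈ G.edgeSet) :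
    ∃ A, IsCut G A e ∧ c ∉ A := by
  induction e with
  | h a b =>
    obtain ⟨A, hA, -⟩ := exists_isCut_of_adj hG he
    by_cases hc : c ∈ A
    · exact ⟨_, hA.compl, by simpa⟩
    · exact ⟨A, hA, hc⟩

/-- A cut avoiding `c` is contained in, or disjoint from, each branch at `c`. -/
lemma IsCut.subset_or_disjoint (hG : G.Connected) {A B : Finset V} {e : Sym2 V} {c b : V}
    (hA : IsCut G A e) (hB : IsCut G B s(c, b)) (ha : c ∉ A) (hb : c ∉ B) :
    A ⊆ B ∨ Disjoint A B := by
  by_cases hbA : b ∈ A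
  · left
    by_cases hcb : G.Adj b c
    · have := hA.2.2 b c hbA ha hcb
      rw [Sym2.eq_swap] at this
      rw [hA.eq_of_notMem hG (this ▸ hB) ha hb]
    · obtain ⟨p, q, -, -, h, h'⟩ := hB.exists_adj hG
      have : s(c, b) ∈ G.edgeSet := h' ▸ h
      exact absurd (G.adj_symm this) hcb
  · by_cases h : A ⊆ B
    · exact Or.inl h
    · right
      obtain ⟨y, hy, hyB⟩ := Finset.not_subset.1 h
      have : IsCut G (A \ B) e := by
        refine IsCut.of_mem (a := y) (b := c) (by simp [hy, hyB]) (by simp [ha]) ?_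
        intro p q hp hq hpq
        by_contra hne
        have h1 := hA.mem_iff hpq hne
        have h2 := hB.mem_iff hpq
        grind
      rw [hA.eq_of_notMem hG this ha (by simp [ha])]
      exact Finset.sdiff_disjoint

lemma IsCut.mem_iff_of_notMem_edges {A : Finset V} {e : Sym2 V} (h : IsCut G A e) {a b : V}
    (w : G.Walk a b) (he : e ∉ w.edges) : a ∈ A ↔ b ∈ A := by
  induction w with
  | nil => rfl
  | cons hadj p ih =>
    simp only [Walk.edges_cons, List.mem_cons, not_or] at he
    rw [h.mem_iff hadj (Ne.symm he.1), ih he.2]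

lemma IsCut.not_mem_iff_of_mem_edges (hG : G.Connected) {A : Finset V} {e : Sym2 V}
    (h : IsCut G A e) {a b : V} (w : G.Walk a b) (hw : w.IsTrail) (he : e ∈ w.edges) :
    ¬ (a ∈ A ↔ b ∈ A) := by
  induction w with
  | nil => simp at he
  | cons hadj p ih =>
    rw [Walk.isTrail_cons] at hw
    by_cases h' : e ∈ p.edges
    · have hne : s(_, _) ≠ e := fun h'' => hw.2 (h'' ▸ h')
      rw [h.mem_iff hadj hne]
      exact ih hw.1 h'
    · simp only [Walk.edges_cons, List.mem_cons, h', or_false] at he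
      subst he
      rw [← h.mem_iff_of_notMem_edges p h']
      exact h.not_mem_iff hG

/-- The vertex set `S` meets both sides of the edge `e`. -/
def Separates (G : SimpleGraph V) (e : Sym2 V) (S : Finset V) : Prop :=
  ∃ A, IsCut G A e ∧ (∃ x ∈ S, x ∈ A) ∧ ∃ y ∈ S, y ∉ A

lemma Separates.mem_edgeSet {e : Sym2 V} {S : Finset V} (h : Separates G e S)
    {H : G.Subgraph} (hH : H.Connected) (hS : ↑S ⊆ H.verts) : e ∈ H.edgeSet := by
  obtain ⟨A, hA, ⟨x, hx, hxA⟩, y, hy, hyA⟩ := h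
  obtain ⟨w⟩ := hH.coe.preconnected ⟨x, hS hx⟩ ⟨y, hS hy⟩
  obtain ⟨d, -, h1, h2⟩ := w.exists_boundary_dart {v | v.1 ∈ A} hxA hyA
  have h3 : H.Adj d.fst.1 d.snd.1 := d.adj
  rw [← hA.2.2 _ _ h1 h2 h3.adj_sub]
  exact h3

lemma exists_connected_subgraph_separates (hG : G.IsTree) (s : V) (S : Finset V) :
    ∃ H : G.Subgraph, H.Connected ∧ s ∈ H.verts ∧ ↑S ⊆ H.verts ∧
      ∀ e ∈ H.edgeSet, Separates G e (insert s S) := by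
  induction S using Finset.induction_on with
  | empty =>
    refine ⟨G.singletonSubgraph s, Subgraph.singletonSubgraph_connected, by simp, by simp, ?_⟩
    simp
  | insert a S ha ih =>
    obtain ⟨H, hH, hs, hS, hsep⟩ := ih
    obtain ⟨w, hw, -⟩ := hG.existsUnique_path s a
    refine ⟨H ⊔ w.toSubgraph,
      Subgraph.connected_sup hH.preconnected w.toSubgraph_connected.preconnected
      ⟨s, hs, w.start_mem_verts_toSubgraph⟩, Or.inl hs, ?_, ?_⟩
    · intro v hv
      rcases Finset.mem_insert.1 hv with rfl | hv
      · exact Or.inr w.end_mem_verts_toSubgraph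
      · exact Or.inl (hS hv)
    · intro e he
      rw [Subgraph.edgeSet_sup] at he
      rcases he with he | he
      · obtain ⟨A, hA, ⟨x, hx, hxA⟩, y, hy, hyA⟩ := hsep e he
        exact ⟨A, hA, ⟨x, by grind, hxA⟩, y, by grind, hyA⟩
      · rw [Walk.mem_edges_toSubgraph] at he
        obtain ⟨A, hA, hsA⟩ := exists_isCut_notMem hG s (w.edges_subset_edgeSet he)
        have := hA.not_mem_iff_of_mem_edges hG.connected w hw.isTrail he
        exact ⟨A, hA, ⟨a, by simp, by tauto⟩, s, by simp, hsA⟩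

lemma steinerDist_eq_card_separates (hG : G.IsTree) {S : Finset V} (hS : S.Nonempty) :
    steinerDist G S = #{e : G.edgeSet | Separates G e S} := by
  obtain ⟨s, hs⟩ := hS
  have hcard : ∀ H : G.Subgraph, H.edgeSet.ncard = #{e : G.edgeSet | e.1 ∈ H.edgeSet} := by
    intro H
    rw [← Set.ncard_coe_finset, ← Set.ncard_image_of_injective _ Subtype.val_injective]
    congr 1
    ext e
    simpa using fun h => H.edgeSet_subset h
  unfold steinerDist
  apply le_antisymm
  · obtain ⟨H, hH, -, hSH, hsep⟩ := exists_connected_subgraph_separates hG s S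
    rw [Finset.insert_eq_of_mem hs] at hsep
    refine le_trans (b := H.edgeSet.ncard) (Nat.sInf_le ⟨H, hH, hSH, rfl⟩) ?_
    rw [hcard]
    exact Finset.card_le_card fun e he => by simpa using hsep _ (by simpa using he)
  · obtain ⟨H, hH, -, hSH, -⟩ := exists_connected_subgraph_separates hG s S
    refine le_csInf ⟨_, H, hH, hSH, rfl⟩ ?_
    rintro n ⟨H, hH, hSH, rfl⟩
    rw [hcard]
    exact Finset.card_le_card fun e he => by
      simpa using (Finset.mem_filter.1 he).2.mem_edgeSet hH hSH

lemma card_separates_add (hG : G.Connected) {k : ℕ} (hk : 1 ≤ k) {A : Finset V} {e : Sym2 V}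
    (hA : IsCut G A e) :
    #{S ∈ powersetCard k (univ : Finset V) | Separates G e S} +
      ((#A).choose k + (Fintype.card V - #A).choose k) = (Fintype.card V).choose k := by
  have hsep : ∀ S : Finset V, Separates G e S ↔ ¬ (S ⊆ A ∨ S ⊆ Aᶜ) := by
    intro S
    constructor
    · rintro ⟨B, hB, ⟨x, hx, hxB⟩, y, hy, hyB⟩ h
      rcases hA.eq_or_eq_compl hG hB with rfl | rfl
      · rcases h with h | h
        · exact hyB (h hy)
        · exact absurd hxB (by simpa using h hx)
      · rcases h with h | h
        · exact absurd hxB (by simpa using h hx)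
        · exact hyB (by simpa using h hy)
    · intro h
      rw [not_or, Finset.not_subset, Finset.not_subset] at h
      obtain ⟨⟨y, hy, hyA⟩, x, hx, hxA⟩ := h
      exact ⟨A, hA, ⟨x, hx, by simpa using hxA⟩, y, hy, hyA⟩
  have hdisj : Disjoint (powersetCard k A) (powersetCard k Aᶜ) := by
    rw [Finset.disjoint_left]
    intro S h1 h2
    rw [Finset.mem_powersetCard] at h1 h2
    obtain ⟨x, hx⟩ : S.Nonempty := by rw [← Finset.card_pos]; omega
    exact absurd (h1.1 hx) (by simpa using h2.1 hx)
  have hnot : {S ∈ powersetCard k (univ : Finset V) | ¬ Separates G e S} =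
      powersetCard k A ∪ powersetCard k Aᶜ := by
    ext S
    simp only [Finset.mem_filter, Finset.mem_powersetCard, hsep, not_not, Finset.mem_union,
      Finset.subset_univ, true_and]
    tauto
  have := Finset.card_filter_add_card_filter_not (s := powersetCard k (univ : Finset V))
    (fun S => Separates G e S)
  rw [hnot, Finset.card_union_of_disjoint hdisj] at this
  simpa [Finset.card_compl] using this

lemma steinerWiener_eq_sum (hG : G.IsTree) {k : ℕ} (hk : 1 ≤ k) :
    steinerWiener G k =
      ∑ e : G.edgeSet, #{S ∈ powersetCard k (univ : Finset V) | Separates G e S} := by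
  unfold steinerWiener
  rw [Finset.sum_congr rfl fun S hS => steinerDist_eq_card_separates hG (S := S) (by
    rw [← Finset.card_pos, (Finset.mem_powersetCard.1 hS).2]; omega)]
  simp only [Finset.card_filter]
  exact Finset.sum_comm

lemma choose_add_choose_le (k a b d : ℕ) (h : a ≤ b) :
    (a + d).choose k + b.choose k ≤ a.choose k + (b + d).choose k := by
  induction d with
  | zero => simp
  | succ d ih =>
    cases k with
    | zero => simp
    | succ j =>
      have h1 := Nat.choose_succ_succ (a + d) j
      have h2 := Nat.choose_succ_succ (b + d) j
      have h3 := Nat.choose_le_choose j (show a + d ≤ b + d by omega)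
      simp only [Nat.succ_eq_add_one] at h1 h2
      rw [← Nat.add_assoc, ← Nat.add_assoc]
      omega

/-- Transferring the edges of one tree to another so that every edge becomes at least as balanced
does not decrease the Steiner Wiener index. -/
lemma steinerWiener_le_of_equiv {W : Type*} [Fintype W] {G' : SimpleGraph W} (hG : G.IsTree)
    (hG' : G'.IsTree) {k : ℕ} (hk : 1 ≤ k) (hcard : Fintype.card V = Fintype.card W)
    (φ : G.edgeSet ≃ G'.edgeSet)
    (h : ∀ e : G.edgeSet, ∃ A A', IsCut G A e ∧ IsCut G' A' (φ e) ∧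
      (#A = #A' ∨ #A ≤ #A' ∧ #A + #A' ≤ Fintype.card V)) :
    steinerWiener G k ≤ steinerWiener G' k := by
  rw [steinerWiener_eq_sum hG hk, steinerWiener_eq_sum hG' hk, ← Equiv.sum_comp φ]
  refine Finset.sum_le_sum fun e _ => ?_
  obtain ⟨A, A', hA, hA', hle⟩ := h e
  have h1 := card_separates_add hG.connected hk hA
  have h2 := card_separates_add hG'.connected hk hA'
  have h3 : (#A').choose k + (Fintype.card W - #A').choose k ≤
      (#A).choose k + (Fintype.card V - #A).choose k := by
    rcases hle with hle | ⟨hle, hle'⟩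
    · rw [hle, hcard]
    · have := choose_add_choose_le k #A (Fintype.card W - #A') (#A' - #A) (by omega)
      rwa [show #A + (#A' - #A) = #A' by omega,
        show Fintype.card W - #A' + (#A' - #A) = Fintype.card V - #A by omega] at this
  rw [← hcard] at h2
  rw [← hcard] at h3
  omega

lemma degN_eq_card_edges (v : V) : degN G v = #{e : G.edgeSet | v ∈ e.1} := by
  have h1 : degN G v = (G.incidenceSet v).ncard :=
    (Nat.card_congr (G.incidenceSetEquivNeighborSet v)).symm
  rw [h1, ← Set.ncard_coe_finset, ← Set.ncard_image_of_injective _ Subtype.val_injective]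
  congr 1
  ext e
  simp [incidenceSet, and_comm]

lemma eq_or_eq_of_degN_le_two {v : V} (hv : degN G v ≤ 2) {e f g : G.edgeSet} (he : v ∈ e.1)
    (hf : v ∈ f.1) (hg : v ∈ g.1) (hef : e ≠ f) : g = e ∨ g = f := by
  by_contra! h
  have h1 : ({e, f, g} : Finset G.edgeSet) ⊆ univ.filter fun e => v ∈ e.1 := by
    intro x hx
    simp only [Finset.mem_insert, Finset.mem_singleton] at hx
    rcases hx with rfl | rfl | rfl <;> simpa
  have h2 := Finset.card_le_card h1
  rw [← degN_eq_card_edges, Finset.card_eq_three.2 ⟨e, f, g, hef, h.1.symm, h.2.symm, rfl⟩] at h2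
  omega

/-- Two edges are linked if they share a vertex of degree two. -/
def EdgeLink (G : SimpleGraph V) (e f : G.edgeSet) : Prop :=
  ∃ v, degN G v = 2 ∧ v ∈ e.1 ∧ v ∈ f.1

/-- The class of an edge under the equivalence relation generated by `EdgeLink`. -/
noncomputable def edgeClass (G : SimpleGraph V) (e : G.edgeSet) : Finset G.edgeSet :=
  {f | Relation.EqvGen (EdgeLink G) e f}

lemma mem_edgeClass {e f : G.edgeSet} :
    f ∈ edgeClass G e ↔ Relation.EqvGen (EdgeLink G) e f := by
  simp [edgeClass]

lemma edgeClass_eq_iff {e f : G.edgeSet} :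
    edgeClass G e = edgeClass G f ↔ Relation.EqvGen (EdgeLink G) e f := by
  constructor
  · intro h
    have : f ∈ edgeClass G f := mem_edgeClass.2 (.refl f)
    rwa [← h, mem_edgeClass] at this
  · intro h
    ext g
    rw [mem_edgeClass, mem_edgeClass]
    exact ⟨fun h' => .trans _ _ _ (.symm _ _ h) h', fun h' => .trans _ _ _ h h'⟩

/-- A path all of whose internal vertices have degree two. -/
def IsSegmentPath {u v : V} (w : G.Walk u v) : Prop :=
  w.IsPath ∧ ∀ x ∈ w.support, x ≠ u → x ≠ v → degN G x = 2

omit [Fintype V] in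
lemma IsSegmentPath.reverse {u v : V} {w : G.Walk u v} (hw : IsSegmentPath w) :
    IsSegmentPath w.reverse :=
  ⟨hw.1.reverse, fun x hx h1 h2 => hw.2 x (by simpa using hx) h2 h1⟩

lemma exists_two_edges_of_mem_support {α : Type*} {H : SimpleGraph α} {u v x : α}
    {w : H.Walk u v} (hw : w.IsPath) (hx : x ∈ w.support) (hu : x ≠ u) (hv : x ≠ v) :
    ∃ p q, p ≠ q ∧ s(x, p) ∈ w.edges ∧ s(x, q) ∈ w.edges := by
  have h1 := Walk.mk_penultimate_end_mem_edges (Walk.not_nil_of_ne (p := w.takeUntil x hx) hu.symm)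
  have h2 := Walk.mk_start_snd_mem_edges (Walk.not_nil_of_ne (p := w.dropUntil x hx) hv)
  have hd := hw.isTrail.disjoint_edges_takeUntil_dropUntil hx
  rw [Sym2.eq_swap] at h1
  refine ⟨_, _, ?_, w.edges_takeUntil_subset_edges hx h1, w.edges_dropUntil_subset_edges hx h2⟩
  intro h
  rw [h] at h1
  exact hd h1 h2

omit [Fintype V] in
lemma IsSegmentPath.eqvGen {u v : V} {w : G.Walk u v} (hw : IsSegmentPath w) :
    ∀ e f : G.edgeSet, e.1 ∈ w.edges → f.1 ∈ w.edges → Relation.EqvGen (EdgeLink G) e f := by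
  induction w with
  | nil => simp
  | @cons a b c hadj p ih =>
    obtain ⟨hp, ha⟩ := (Walk.cons_isPath_iff _ _).1 hw.1
    have ih := ih ⟨hp, fun x hx h1 h2 => hw.2 x (by simp [hx]) (fun h => ha (h ▸ hx)) h2⟩
    have key : ∀ g : G.edgeSet, g.1 ∈ p.edges →
        Relation.EqvGen (EdgeLink G) ⟨s(a, b), hadj⟩ g := by
      intro g hg
      cases p with
      | nil => simp at hg
      | @cons _ d _ hadj' p' =>
        obtain ⟨hp', hb⟩ := (Walk.cons_isPath_iff _ _).1 hp
        refine .trans _ ⟨s(b, d), hadj'⟩ _ (.rel _ _ ⟨b, ?_, by simp, by simp⟩)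
          (ih _ _ (by simp) hg)
        exact hw.2 b (by simp) hadj.ne' fun h => hb (h ▸ p'.end_mem_support)
    intro e f he hf
    rw [Walk.edges_cons, List.mem_cons] at he hf
    have heq : ∀ g : G.edgeSet, g.1 = s(a, b) → g = ⟨s(a, b), hadj⟩ := fun g hg => Subtype.ext hg
    rcases he with he | he <;> rcases hf with hf | hf
    · rw [heq e he, heq f hf]
      exact .refl _
    · rw [heq e he]
      exact key f hf
    · rw [heq f hf]
      exact .symm _ _ (key e he)
    · exact ih e f he hf

lemma IsSegmentPath.mem_edges_of_edgeLink {u v : V} {w : G.Walk u v} (hw : IsSegmentPath w)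
    (hu : degN G u ≠ 2) (hv : degN G v ≠ 2) {e f : G.edgeSet} (h : EdgeLink G e f)
    (he : e.1 ∈ w.edges) : f.1 ∈ w.edges := by
  obtain ⟨x, hx, hxe, hxf⟩ := h
  obtain ⟨p, q, hpq, h1, h2⟩ := exists_two_edges_of_mem_support hw.1
    (Walk.mem_support_of_mem_edges he hxe) (fun h => hu (h ▸ hx)) (fun h => hv (h ▸ hx))
  have := eq_or_eq_of_degN_le_two hx.le (e := ⟨_, w.edges_subset_edgeSet h1⟩)
    (f := ⟨_, w.edges_subset_edgeSet h2⟩) (g := f) (by simp) (by simp) hxf (by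
      intro h
      exact hpq (Sym2.congr_right.1 (Subtype.ext_iff.1 h)))
  rcases this with h | h <;> rw [h] <;> assumption

lemma IsSegmentPath.mem_edgeClass_iff {u v : V} {w : G.Walk u v} (hw : IsSegmentPath w)
    (hu : degN G u ≠ 2) (hv : degN G v ≠ 2) {e f : G.edgeSet} (he : e.1 ∈ w.edges) :
    f ∈ edgeClass G e ↔ f.1 ∈ w.edges := by
  rw [mem_edgeClass]
  refine ⟨fun h => ?_, hw.eqvGen e f he⟩
  have : e.1 ∈ w.edges ↔ f.1 ∈ w.edges := by
    clear he
    induction h with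
    | rel x y h =>
      obtain ⟨z, hz, h1, h2⟩ := h
      exact ⟨hw.mem_edges_of_edgeLink hu hv ⟨z, hz, h1, h2⟩,
        hw.mem_edges_of_edgeLink hu hv ⟨z, hz, h2, h1⟩⟩
    | refl => rfl
    | symm _ _ _ ih => exact ih.symm
    | trans _ _ _ _ _ ih1 ih2 => exact ih1.trans ih2
  exact this.1 he

lemma IsSegmentPath.card_edgeClass {u v : V} {w : G.Walk u v} (hw : IsSegmentPath w)
    (hu : degN G u ≠ 2) (hv : degN G v ≠ 2) {e : G.edgeSet} (he : e.1 ∈ w.edges) :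
    #(edgeClass G e) = w.length := by
  rw [← Walk.length_edges, ← List.toFinset_card_of_nodup hw.1.isTrail.edges_nodup,
    ← Finset.card_map (Function.Embedding.subtype (· ∈ G.edgeSet))]
  congr 1
  ext f
  simp only [Finset.mem_map, Function.Embedding.subtype_apply, List.mem_toFinset]
  constructor
  · rintro ⟨g, hg, rfl⟩
    exact (hw.mem_edgeClass_iff hu hv he).1 hg
  · intro hf
    exact ⟨⟨f, w.edges_subset_edgeSet hf⟩, (hw.mem_edgeClass_iff hu hv he).2 hf, rfl⟩

lemma IsSegmentPath.mem_sym2_iff {u v : V} {w : G.Walk u v} (hw : IsSegmentPath w)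
    (hu : degN G u ≠ 2) (hv : degN G v ≠ 2) {e : G.edgeSet} (he : e.1 ∈ w.edges) (x : V) :
    x ∈ s(u, v) ↔ degN G x ≠ 2 ∧ ∃ f ∈ edgeClass G e, x ∈ f.1 := by
  have hnil : ¬ w.Nil := by
    cases w with
    | nil => simp at he
    | cons => simp
  constructor
  · intro hx
    have hx' : x ∈ w.support ∧ degN G x ≠ 2 := by
      rcases Sym2.mem_iff.1 hx with rfl | rfl
      · exact ⟨w.start_mem_support, hu⟩
      · exact ⟨w.end_mem_support, hv⟩
    obtain ⟨f, hf, hxf⟩ := (Walk.mem_support_iff_exists_mem_edges_of_not_nil hnil).1 hx'.1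
    exact ⟨hx'.2, ⟨f, w.edges_subset_edgeSet hf⟩, (hw.mem_edgeClass_iff hu hv he).2 hf, hxf⟩
  · rintro ⟨hx, f, hf, hxf⟩
    have := Walk.mem_support_of_mem_edges ((hw.mem_edgeClass_iff hu hv he).1 hf) hxf
    by_contra hne
    rw [Sym2.mem_iff, not_or] at hne
    exact hx (hw.2 x this hne.1 hne.2)

lemma one_le_degN {a b : V} (h : G.Adj a b) : 1 ≤ degN G a := by
  rw [degN_eq_card_edges, Nat.one_le_iff_ne_zero, ← Nat.pos_iff_ne_zero, Finset.card_pos]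
  exact ⟨⟨s(a, b), h⟩, by simp⟩

lemma isLeafV_or_isBranchV {a b : V} (h : G.Adj a b) (ha : degN G a ≠ 2) :
    IsLeafV G a ∨ IsBranchV G a := by
  have := one_le_degN h
  unfold IsLeafV IsBranchV
  omega

omit [Fintype V] in
lemma degN_ne_two_of_or {a : V} (h : IsLeafV G a ∨ IsBranchV G a) : degN G a ≠ 2 := by
  unfold IsLeafV IsBranchV at h
  omega

lemma exists_adj_notMem_support (hG : G.IsTree) {a b : V} {w : G.Walk a b} (hw : w.IsPath)
    (hb : degN G b = 2) : ∃ c, G.Adj b c ∧ c ∉ w.support := by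
  by_contra! h
  have h1 : G.neighborSet b ⊆ {w.penultimate} := fun c hc =>
    hG.2.eq_penultimate_of_adj_end hw hc (h c hc)
  have h2 := Set.ncard_le_ncard h1
  rw [Set.ncard_singleton] at h2
  unfold degN at hb
  omega

lemma IsSegmentPath.concat (hG : G.IsTree) {a b : V} {w : G.Walk a b} (hw : IsSegmentPath w)
    (hb : degN G b = 2) : ∃ (c : V) (h : G.Adj b c), IsSegmentPath (w.concat h) := by
  obtain ⟨c, hc, hcw⟩ := exists_adj_notMem_support hG hw.1 hb
  refine ⟨c, hc, hw.1.concat hcw hc, fun x hx h1 h2 => ?_⟩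
  rw [Walk.support_concat] at hx
  by_cases hxb : x = b
  · rw [hxb, hb]
  · exact hw.2 x (by simpa [h2] using hx) h1 hxb

lemma exists_isSegment_of_mem_edgeSet (hG : G.IsTree) (e : G.edgeSet) :
    ∃ (a b : V) (w : G.Walk a b), IsSegment G a b ∧ IsSegmentPath w ∧ e.1 ∈ w.edges := by
  by_contra! hno
  have key : ∀ n : ℕ, ∃ (a b : V) (w : G.Walk a b), IsSegmentPath w ∧ e.1 ∈ w.edges ∧
      n ≤ w.length := by
    intro n
    induction n with
    | zero =>
      obtain ⟨e, he⟩ := e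
      induction e with
      | h a b =>
        have he' : G.Adj a b := he
        refine ⟨a, b, .cons he' .nil, ⟨?_, ?_⟩, by simp, by simp⟩
        · simpa using he'.ne
        · intro x hx h1 h2
          simp [h1, h2] at hx
    | succ n ih =>
      obtain ⟨a, b, w, hw, he, hn⟩ := ih
      by_cases hb : degN G b = 2
      · obtain ⟨c, hc, hwc⟩ := hw.concat hG hb
        exact ⟨a, c, w.concat hc, hwc, by simp [he], by simpa⟩
      by_cases ha : degN G a = 2
      · obtain ⟨c, hc, hwc⟩ := hw.reverse.concat hG ha
        exact ⟨b, c, w.reverse.concat hc, hwc, by simp [he], by simpa⟩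
      have hnil : ¬ w.Nil := by
        cases w with
        | nil => simp at he
        | cons => simp
      refine absurd he (hno a b w ⟨?_, ?_, ?_, w, hw⟩ hw)
      · rintro rfl
        exact hnil (Walk.isPath_iff_nil.1 hw.1)
      · exact isLeafV_or_isBranchV (w.adj_snd hnil) ha
      · exact isLeafV_or_isBranchV (w.adj_penultimate hnil).symm hb
  obtain ⟨a, b, w, hw, -, hn⟩ := key (Fintype.card V)
  exact absurd hw.1.length_lt (by omega)

omit [Fintype V] in
lemma dist_eq_length_of_isPath (hG : G.IsTree) {a b : V} {w : G.Walk a b} (hw : w.IsPath) :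
    G.dist a b = w.length := by
  obtain ⟨p, hp, hlen⟩ := hG.connected.exists_path_of_dist a b
  rw [← hlen, (hG.existsUnique_path a b).unique hp hw]

omit [Fintype V] in
lemma mem_edges_of_sym2_eq (hG : G.IsTree) {a b u v : V} {w : G.Walk a b} {p : G.Walk u v}
    (hw : w.IsPath) (hp : p.IsPath) (h : s(u, v) = s(a, b)) {e : Sym2 V} (he : e ∈ p.edges) :
    e ∈ w.edges := by
  rcases Sym2.eq_iff.1 h with ⟨rfl, rfl⟩ | ⟨rfl, rfl⟩
  · rwa [(hG.existsUnique_path _ _).unique hw hp]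
  · rw [(hG.existsUnique_path _ _).unique hw hp.reverse]
    simpa using he

omit [Fintype V] in
lemma IsSegment.exists_edge {a b : V} (h : IsSegment G a b) :
    ∃ (w : G.Walk a b) (e : G.edgeSet), IsSegmentPath w ∧ e.1 ∈ w.edges := by
  obtain ⟨hne, -, -, w, hw⟩ := h
  have := Walk.mk_start_snd_mem_edges (Walk.not_nil_of_ne (p := w) hne)
  exact ⟨w, ⟨_, w.edges_subset_edgeSet this⟩, hw, this⟩

lemma segmentMultiset_eq (hG : G.IsTree) :
    segmentMultiset G = (univ.image (edgeClass G)).val.map Finset.card := by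
  have hseg : ∀ s ∈ ((Set.toFinite {e : Sym2 V | ∃ u v, e = s(u, v) ∧
      IsSegment G u v}).toFinset).val, ∃ (a b : V) (w : G.Walk a b) (e : G.edgeSet),
        s = s(a, b) ∧ IsSegment G a b ∧ IsSegmentPath w ∧ e.1 ∈ w.edges := by
    intro s hs
    rw [Finset.mem_val, Set.Finite.mem_toFinset] at hs
    obtain ⟨a, b, rfl, h⟩ := hs
    obtain ⟨w, e, hw, he⟩ := h.exists_edge
    exact ⟨a, b, w, e, rfl, h, hw, he⟩
  choose a b w e hs h hw he using hseg
  have hu := fun s hs' => degN_ne_two_of_or (h s hs').2.1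
  have hv := fun s hs' => degN_ne_two_of_or (h s hs').2.2.1
  refine Multiset.map_eq_map_of_bij_of_nodup _ _ (Finset.nodup _) (Finset.nodup _)
    (fun s hs => edgeClass G (e s hs)) ?_ ?_ ?_ ?_
  · intro s hs
    simp
  · intro s hs' t ht heq
    rw [hs s hs', hs t ht]
    refine Sym2.ext fun x => ?_
    rw [(hw s hs').mem_sym2_iff (hu s hs') (hv s hs') (he s hs'),
      (hw t ht).mem_sym2_iff (hu t ht) (hv t ht) (he t ht), heq]
  · intro C hC
    obtain ⟨f, -, rfl⟩ := Finset.mem_image.1 hC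
    obtain ⟨u, v, p, hseg, hp, hf⟩ := exists_isSegment_of_mem_edgeSet hG f
    have hmem : s(u, v) ∈ ((Set.toFinite {e : Sym2 V | ∃ u v, e = s(u, v) ∧
      IsSegment G u v}).toFinset).val := by
      rw [Finset.mem_val, Set.Finite.mem_toFinset]
      exact ⟨u, v, rfl, hseg⟩
    refine ⟨s(u, v), hmem, ?_⟩
    rw [edgeClass_eq_iff, ← mem_edgeClass, IsSegmentPath.mem_edgeClass_iff (hw _ hmem)
      (hu _ hmem) (hv _ hmem) (he _ hmem)]
    exact mem_edges_of_sym2_eq hG (hw _ hmem).1 hp.1 (hs _ hmem) hf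
  · intro s hs'
    conv_lhs => rw [hs s hs']
    rw [(hw s hs').card_edgeClass (hu s hs') (hv s hs') (he s hs')]
    exact dist_eq_length_of_isPath hG (hw s hs').1

omit [Fintype V] in
lemma eqvGen_map {α β : Type*} {r : α → α → Prop} {s : β → β → Prop} {f : α → β}
    (h : ∀ a b, r a b → s (f a) (f b)) {a b : α} (hab : Relation.EqvGen r a b) :
    Relation.EqvGen s (f a) (f b) := by
  induction hab with
  | rel _ _ h' => exact .rel _ _ (h _ _ h')
  | refl => exact .refl _
  | symm _ _ _ ih => exact .symm _ _ ih
  | trans _ _ _ _ _ ih1 ih2 => exact .trans _ _ _ ih1 ih2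

/-- The segment sequence only depends on the links between edges. -/
lemma segmentMultiset_congr {W : Type*} [Fintype W] {G' : SimpleGraph W} (hG : G.IsTree)
    (hG' : G'.IsTree) (φ : G.edgeSet ≃ G'.edgeSet)
    (h : ∀ e f, EdgeLink G e f ↔ EdgeLink G' (φ e) (φ f)) :
    segmentMultiset G = segmentMultiset G' := by
  have hcls : ∀ e, edgeClass G' (φ e) = (edgeClass G e).map φ.toEmbedding := by
    intro e
    ext f
    obtain ⟨f, rfl⟩ := φ.surjective f
    simp only [mem_edgeClass, Finset.mem_map_equiv, φ.symm_apply_apply]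
    constructor
    · intro hf
      simpa using eqvGen_map (f := φ.symm) (s := EdgeLink G)
        (fun a b hab => (h _ _).2 (by simpa using hab)) hf
    · exact eqvGen_map fun a b hab => (h a b).1 hab
  have himg : univ.image (edgeClass G') =
      (univ.image (edgeClass G)).map (Finset.mapEmbedding φ.toEmbedding).toEmbedding := by
    ext C
    simp only [Finset.mem_image, Finset.mem_univ, true_and, Finset.mem_map]
    constructor
    · rintro ⟨f, rfl⟩
      obtain ⟨e, rfl⟩ := φ.surjective f
      exact ⟨_, ⟨e, rfl⟩, (hcls e).symm⟩
    · rintro ⟨_, ⟨e, rfl⟩, rfl⟩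
      exact ⟨φ e, hcls e⟩
  rw [segmentMultiset_eq hG, segmentMultiset_eq hG', himg, Finset.map_val, Multiset.map_map]
  refine Multiset.map_congr rfl fun C _ => ?_
  simp [Finset.mapEmbedding_apply]

lemma sum_segmentMultiset_add_one (hG : G.IsTree) :
    (segmentMultiset G).sum + 1 = Fintype.card V := by
  have h1 : (segmentMultiset G).sum = Fintype.card G.edgeSet := by
    rw [segmentMultiset_eq hG, ← Finset.card_univ,
      Finset.card_eq_sum_card_image (edgeClass G) univ]
    refine Finset.sum_congr rfl fun C hC => ?_
    obtain ⟨e, -, rfl⟩ := Finset.mem_image.1 hC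
    congr 1
    ext f
    simp only [Finset.mem_filter, Finset.mem_univ, true_and, mem_edgeClass, edgeClass_eq_iff]
    exact ⟨fun h => .symm _ _ h, fun h => .symm _ _ h⟩
  rw [h1, ← hG.card_edgeFinset, edgeFinset_card]

lemma connected_of_forall_not_adj (r : V) (h : ∀ D : Finset V,
    (∀ p q, p ∈ D → q ∉ D → ¬ G.Adj p q) → D = ∅ ∨ D = univ) : G.Connected := by
  have : Nonempty V := ⟨r⟩
  refine (connected_iff_exists_forall_reachable G).2 ⟨r, fun v => ?_⟩
  rcases h (univ.filter fun y => G.Reachable r y) (by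
    intro p q hp hq hpq
    simp only [Finset.mem_filter, Finset.mem_univ, true_and] at hp hq
    exact hq (hp.trans hpq.reachable)) with h' | h'
  · exact absurd (h' ▸ (by simp : r ∈ univ.filter fun y => G.Reachable r y)) (by simp)
  · have hv := Finset.mem_univ v
    rw [← h'] at hv
    simpa using hv

/-- A permutation of pairs exchanging `cb` with `ub` and `ux` with `cx`. -/
noncomputable def switchPerm (c u b x : V) : Equiv.Perm (Sym2 V) :=
  (Equiv.swap s(c, b) s(u, b)).trans (Equiv.swap s(u, x) s(c, x))

/-- The graph obtained by replacing the edges `cb` and `ux` by `ub` and `cx`. -/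
noncomputable def switchGraph (G : SimpleGraph V) (c u b x : V) : SimpleGraph V :=
  fromEdgeSet (switchPerm c u b x '' G.edgeSet)

/-- Disjoint branches `B` at `c` and `X` at `u`, entered through `b` and `x` respectively, whose
positions may be exchanged. -/
structure Switchable (G : SimpleGraph V) (c u b x : V) (B X : Finset V) : Prop where
  adj_cb : G.Adj c b
  adj_ux : G.Adj u x
  ne : c ≠ u
  isCut_B : IsCut G B s(c, b)
  isCut_X : IsCut G X s(u, x)
  b_mem_B : b ∈ B
  c_notMem_B : c ∉ B
  u_notMem_B : u ∉ B
  x_notMem_B : x ∉ B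
  x_mem_X : x ∈ X
  c_notMem_X : c ∉ X
  u_notMem_X : u ∉ X
  b_notMem_X : b ∉ X

namespace Switchable

variable {c u b x : V} {B X : Finset V}

lemma distinct (h : Switchable G c u b x B X) :
    c ≠ b ∧ u ≠ b ∧ u ≠ x ∧ c ≠ x ∧ b ≠ x := by
  obtain ⟨h1, h2, h3, h4, h5, h6, h7, h8, h9, h10, h11, h12, h13⟩ := h
  refine ⟨?_, ?_, ?_, ?_, ?_⟩ <;> rintro rfl <;> contradiction

lemma not_adj_ub (h : Switchable G c u b x B X) : ¬ G.Adj u b := by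
  intro hub
  have := h.isCut_B.2.2 b u h.b_mem_B h.u_notMem_B hub.symm
  rw [Sym2.eq_swap] at this
  exact h.ne (Sym2.congr_left.1 this).symm

lemma not_adj_cx (h : Switchable G c u b x B X) : ¬ G.Adj c x := by
  intro hcx
  have := h.isCut_X.2.2 x c h.x_mem_X h.c_notMem_X hcx.symm
  rw [Sym2.eq_swap] at this
  exact h.ne (Sym2.congr_left.1 this)

lemma switchPerm_apply (h : Switchable G c u b x B X) {e : Sym2 V} (he : e ∈ G.edgeSet) :
    (e = s(c, b) ∧ switchPerm c u b x e = s(u, b)) ∨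
    (e = s(u, x) ∧ switchPerm c u b x e = s(c, x)) ∨
    (e ≠ s(c, b) ∧ e ≠ s(u, x) ∧ switchPerm c u b x e = e) := by
  obtain ⟨h1, h2, h3, h4, h5⟩ := h.distinct
  have h6 := h.ne
  have n1 : e ≠ s(u, b) := fun h' => h.not_adj_ub (by rw [← mem_edgeSet, ← h']; exact he)
  have n2 : e ≠ s(c, x) := fun h' => h.not_adj_cx (by rw [← mem_edgeSet, ← h']; exact he)
  have n3 : s(u, b) ≠ s(u, x) := by rw [Ne, Sym2.eq_iff]; grind
  have n4 : s(u, b) ≠ s(c, x) := by rw [Ne, Sym2.eq_iff]; grind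
  have n5 : s(u, x) ≠ s(c, b) := by rw [Ne, Sym2.eq_iff]; grind
  unfold switchPerm
  rw [Equiv.trans_apply]
  by_cases e1 : e = s(c, b)
  · left
    rw [e1, Equiv.swap_apply_left, Equiv.swap_apply_of_ne_of_ne n3 n4]
    simp
  by_cases e2 : e = s(u, x)
  · right; left
    rw [e2, Equiv.swap_apply_of_ne_of_ne n5 n3.symm, Equiv.swap_apply_left]
    simp
  · right; right
    rw [Equiv.swap_apply_of_ne_of_ne e1 n1, Equiv.swap_apply_of_ne_of_ne e2 n2]
    simp [e1, e2]

lemma edgeSet_switchGraph (h : Switchable G c u b x B X) :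
    (switchGraph G c u b x).edgeSet = switchPerm c u b x '' G.edgeSet := by
  unfold switchGraph
  rw [edgeSet_fromEdgeSet, sdiff_eq_left, Set.disjoint_left]
  rintro _ ⟨e, he, rfl⟩ hd
  obtain ⟨h1, h2, h3, h4, h5⟩ := h.distinct
  rcases h.switchPerm_apply he with ⟨-, h'⟩ | ⟨-, h'⟩ | ⟨-, -, h'⟩ <;> rw [h'] at hd
  · exact h2 (by simpa using hd)
  · exact h4 (by simpa using hd)
  · exact G.not_isDiag_of_mem_edgeSet he (by simpa using hd)

lemma switchGraph_adj (h : Switchable G c u b x B X) {p q : V} :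
    (switchGraph G c u b x).Adj p q ↔
      (G.Adj p q ∧ s(p, q) ≠ s(c, b) ∧ s(p, q) ≠ s(u, x)) ∨
        s(p, q) = s(u, b) ∨ s(p, q) = s(c, x) := by
  rw [← mem_edgeSet, h.edgeSet_switchGraph]
  constructor
  · rintro ⟨e, he, h'⟩
    rcases h.switchPerm_apply he with ⟨-, h''⟩ | ⟨-, h''⟩ | ⟨h1, h2, h''⟩ <;> rw [h''] at h'
    · exact Or.inr (Or.inl h'.symm)
    · exact Or.inr (Or.inr h'.symm)
    · subst h'
      exact Or.inl ⟨he, h1, h2⟩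
  · rintro (⟨h1, h2, h3⟩ | h' | h')
    · refine ⟨s(p, q), h1, ?_⟩
      rcases h.switchPerm_apply (e := s(p, q)) h1 with ⟨h'', -⟩ | ⟨h'', -⟩ | ⟨-, -, h''⟩
      · exact absurd h'' h2
      · exact absurd h'' h3
      · exact h''
    · refine ⟨s(c, b), h.adj_cb, ?_⟩
      rw [h']
      rcases h.switchPerm_apply (e := s(c, b)) h.adj_cb with ⟨-, h''⟩ | ⟨h'', -⟩ | ⟨h'', -⟩
      · exact h''
      · have := h.distinct
        have := h.ne
        simp at h''
        grind
      · exact absurd rfl h''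
    · refine ⟨s(u, x), h.adj_ux, ?_⟩
      rw [h']
      rcases h.switchPerm_apply (e := s(u, x)) h.adj_ux with ⟨h'', -⟩ | ⟨-, h''⟩ | ⟨-, h'', -⟩
      · have := h.distinct
        have := h.ne
        simp at h''
        grind
      · exact h''
      · exact absurd rfl h''

/-- The bijection between the edges before and after the switch. -/
noncomputable def edgeEquiv (h : Switchable G c u b x B X) :
    G.edgeSet ≃ (switchGraph G c u b x).edgeSet :=
  (switchPerm c u b x).subtypeEquiv fun e => by
    change e ∈ G.edgeSet ↔ switchPerm c u b x e ∈ (switchGraph G c u b x).edgeSet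
    rw [h.edgeSet_switchGraph, (switchPerm c u b x).injective.mem_set_image]

lemma edgeEquiv_apply (h : Switchable G c u b x B X) (e : G.edgeSet) :
    (e.1 = s(c, b) ∧ (h.edgeEquiv e).1 = s(u, b)) ∨
    (e.1 = s(u, x) ∧ (h.edgeEquiv e).1 = s(c, x)) ∨
    (e.1 ≠ s(c, b) ∧ e.1 ≠ s(u, x) ∧ (h.edgeEquiv e).1 = e.1) :=
  h.switchPerm_apply e.2

lemma mem_edgeEquiv_iff (h : Switchable G c u b x B X) (e : G.edgeSet) {v : V} (hc : v ≠ c)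
    (hu : v ≠ u) : v ∈ (h.edgeEquiv e).1 ↔ v ∈ e.1 := by
  rcases h.edgeEquiv_apply e with ⟨h1, h2⟩ | ⟨h1, h2⟩ | ⟨-, -, h2⟩
  · simp [h1, h2, hc, hu]
  · simp [h1, h2, hc, hu]
  · rw [h2]

lemma connected_switchGraph (h : Switchable G c u b x B X) (hG : G.Connected) :
    (switchGraph G c u b x).Connected := by
  refine connected_of_forall_not_adj c fun D hD => ?_
  have hD' : ∀ p q, (switchGraph G c u b x).Adj p q → (p ∈ D ↔ q ∈ D) := fun p q hpq =>
    ⟨fun hp => by_contra fun hq => hD p q hp hq hpq,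
      fun hq => by_contra fun hp => hD q p hq hp hpq.symm⟩
  have hub : u ∈ D ↔ b ∈ D := hD' _ _ (h.switchGraph_adj.2 (by simp))
  have hcx : c ∈ D ↔ x ∈ D := hD' _ _ (h.switchGraph_adj.2 (by simp))
  have hold : ∀ p q, G.Adj p q → s(p, q) ≠ s(c, b) → s(p, q) ≠ s(u, x) → (p ∈ D ↔ q ∈ D) :=
    fun p q h1 h2 h3 => hD' _ _ (h.switchGraph_adj.2 (Or.inl ⟨h1, h2, h3⟩))
  by_cases hcu : c ∈ D ↔ u ∈ D
  · refine eq_empty_or_univ_of_not_adj hG D fun p q hp hq hpq => ?_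
    by_cases h1 : s(p, q) = s(c, b)
    · rw [Sym2.eq_iff] at h1
      grind
    by_cases h2 : s(p, q) = s(u, x)
    · rw [Sym2.eq_iff] at h2
      grind
    have := hold p q hpq h1 h2
    tauto
  · exfalso
    have key : ∀ p q, G.Adj p q →
        ((p ∈ D ↔ p ∈ B ∨ p ∈ X) ↔ (q ∈ D ↔ q ∈ B ∨ q ∈ X)) := by
      intro p q hpq
      obtain ⟨a1, a2, a3, a4, a5, a6, a7, a8, a9, b1, b2, b3, b4⟩ := h
      by_cases h1 : s(p, q) = s(c, b)
      · rw [Sym2.eq_iff] at h1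
        rcases h1 with ⟨rfl, rfl⟩ | ⟨rfl, rfl⟩ <;> tauto
      by_cases h2 : s(p, q) = s(u, x)
      · rw [Sym2.eq_iff] at h2
        rcases h2 with ⟨rfl, rfl⟩ | ⟨rfl, rfl⟩ <;> tauto
      rw [hold p q hpq h1 h2, a4.mem_iff hpq h1, a5.mem_iff hpq h2]
    have h1 := h.c_notMem_B
    have h2 := h.c_notMem_X
    have h3 := h.u_notMem_B
    have h4 := h.u_notMem_X
    rcases eq_empty_or_univ_of_not_adj hG (univ.filter fun v => (v ∈ D ↔ v ∈ B ∨ v ∈ X)) (by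
      intro p q hp hq hpq
      simp only [Finset.mem_filter, Finset.mem_univ, true_and] at hp hq
      exact hq ((key p q hpq).1 hp)) with h' | h' <;>
    · have hc := Finset.ext_iff.1 h' c
      have hu := Finset.ext_iff.1 h' u
      simp only [Finset.mem_filter, Finset.mem_univ, true_and, Finset.notMem_empty] at hc hu
      tauto

lemma isTree_switchGraph (h : Switchable G c u b x B X) (hG : G.IsTree) :
    (switchGraph G c u b x).IsTree := by
  rw [isTree_iff_connected_and_card]
  refine ⟨h.connected_switchGraph hG.connected, ?_⟩
  rw [← Nat.card_congr h.edgeEquiv]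
  exact (isTree_iff_connected_and_card.1 hG).2

lemma degN_switchGraph (h : Switchable G c u b x B X) (v : V) :
    degN (switchGraph G c u b x) v = degN G v := by
  obtain ⟨h1, h2, h3, h4, h5⟩ := h.distinct
  have h6 := h.ne
  have h7 := h.not_adj_ub
  have h8 := h.not_adj_cx
  have h9 := h.adj_cb
  have h10 := h.adj_ux
  have key : ∃ τ : Equiv.Perm V, ∀ y, (switchGraph G c u b x).Adj v y ↔ G.Adj v (τ y) := by
    simp only [h.switchGraph_adj, Sym2.eq_iff]
    have aux : ∀ p q r : V, G.Adj p q → ¬ G.Adj p r → q ≠ r → ∀ P : V → Prop,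
        (∀ y, P y ↔ (G.Adj p y ∧ y ≠ q) ∨ y = r) → ∀ y, P y ↔ G.Adj p (Equiv.swap q r y) := by
      intro p q r hq hr hqr P hP y
      rw [hP, Equiv.swap_apply_def]
      split_ifs with e1 e2
      · simp [e1, hqr, hr]
      · simp [e2, hq]
      · simp [e1, e2]
    by_cases hvc : v = c
    · subst hvc
      refine ⟨Equiv.swap b x, aux v b x h9 h8 h5 _ fun y => ?_⟩
      simp [h1, h4, h6]
    by_cases hvu : v = u
    · subst hvu
      refine ⟨Equiv.swap x b, aux v x b h10 h7 h5.symm _ fun y => ?_⟩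
      simp [h2, h3, h6.symm]
    by_cases hvb : v = b
    · subst hvb
      refine ⟨Equiv.swap c u, aux v c u h9.symm (fun h => h7 h.symm) h6 _ fun y => ?_⟩
      simp [h5, h1.symm, h2.symm]
    by_cases hvx : v = x
    · subst hvx
      refine ⟨Equiv.swap u c, aux v u c h10.symm (fun h => h8 h.symm) h6.symm _ fun y => ?_⟩
      simp [h3.symm, h4.symm, h5.symm]
    · exact ⟨1, fun y => by simp [*]⟩
  obtain ⟨τ, hτ⟩ := key
  unfold degN
  rw [show (switchGraph G c u b x).neighborSet v = τ.symm '' G.neighborSet v by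
    ext y
    simp [Equiv.image_eq_preimage_symm, hτ]]
  exact Set.ncard_image_of_injective _ τ.symm.injective

lemma segmentMultiset_switchGraph (h : Switchable G c u b x B X) (hG : G.IsTree)
    (hc : degN G c ≠ 2) (hu : degN G u ≠ 2) :
    segmentMultiset (switchGraph G c u b x) = segmentMultiset G := by
  refine (segmentMultiset_congr hG (h.isTree_switchGraph hG) h.edgeEquiv fun e f => ?_).symm
  refine exists_congr fun v => ?_
  rw [h.degN_switchGraph]
  refine and_congr_right fun hv => ?_
  have hvc : v ≠ c := fun h' => hc (h' ▸ hv)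
  have hvu : v ≠ u := fun h' => hu (h' ▸ hv)
  rw [h.mem_edgeEquiv_iff e hvc hvu, h.mem_edgeEquiv_iff f hvc hvu]

lemma isCut_switchGraph (h : Switchable G c u b x B X) {A : Finset V} {e : Sym2 V} {a d : V}
    (ha : a ∈ A) (hd : d ∉ A)
    (hold : ∀ p q, G.Adj p q → s(p, q) ≠ s(c, b) → s(p, q) ≠ s(u, x) → s(p, q) ≠ e →
      (p ∈ A ↔ q ∈ A))
    (hub : s(u, b) ≠ e → (u ∈ A ↔ b ∈ A)) (hcx : s(c, x) ≠ e → (c ∈ A ↔ x ∈ A)) :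
    IsCut (switchGraph G c u b x) A e := by
  refine IsCut.of_mem ha hd fun p q hp hq hpq => ?_
  by_contra hne
  rcases h.switchGraph_adj.1 hpq with ⟨h1, h2, h3⟩ | h1 | h1
  · exact hq ((hold p q h1 h2 h3 hne).1 hp)
  · rw [h1] at hne
    have := hub hne
    rcases Sym2.eq_iff.1 h1 with ⟨rfl, rfl⟩ | ⟨rfl, rfl⟩ <;> tauto
  · rw [h1] at hne
    have := hcx hne
    rcases Sym2.eq_iff.1 h1 with ⟨rfl, rfl⟩ | ⟨rfl, rfl⟩ <;> tauto

/-- How the side of an edge not containing `c` changes under the switch. -/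
lemma exists_isCut (h : Switchable G c u b x B X) (hG : G.Connected) {e : G.edgeSet}
    {A : Finset V} (hA : IsCut G A e) (hc : c ∉ A) :
    (u ∉ A ∧ IsCut (switchGraph G c u b x) A (h.edgeEquiv e)) ∨
      (u ∈ A ∧ X ⊆ A ∧ Disjoint A B ∧
        IsCut (switchGraph G c u b x) ((A ∪ B) \ X) (h.edgeEquiv e)) := by
  have hS := h
  obtain ⟨a1, a2, a3, a4, a5, a6, a7, a8, a9, b1, b2, b3, b4⟩ := h
  rcases hS.edgeEquiv_apply e with ⟨h1, h2⟩ | ⟨h1, h2⟩ | ⟨h0, h1, h2⟩ <;> rw [h2]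
  · rw [h1] at hA
    obtain rfl := hA.eq_of_notMem hG a4 hc a7
    refine Or.inl ⟨a8, hS.isCut_switchGraph a6 a7 (fun p q hpq h1 _ _ => a4.mem_iff hpq h1)
      (fun h => absurd rfl h) fun _ => by tauto⟩
  · rw [h1] at hA
    obtain rfl := hA.eq_of_notMem hG a5 hc b2
    refine Or.inl ⟨b3, hS.isCut_switchGraph b1 b2 (fun p q hpq _ h1 _ => a5.mem_iff hpq h1)
      (fun _ => by tauto) fun h => absurd rfl h⟩
  · have e1 := hA.mem_iff a1 (Ne.symm h0)
    have e2 := hA.mem_iff a2 (Ne.symm h1)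
    by_cases hu : u ∈ A
    · replace e2 := e2.1 hu
      have hXA : A ∪ X = A := by
        refine IsCut.eq_of_notMem hG
          (IsCut.of_mem (Finset.mem_union_left _ hu) (b := c) (by simp [*]) fun p q hp hq hpq => ?_) hA (c := c) (by simp [*]) hc
        by_contra hne
        have f1 := hA.mem_iff hpq hne
        by_cases f2 : s(p, q) = s(u, x)
        · rcases Sym2.eq_iff.1 f2 with ⟨rfl, rfl⟩ | ⟨rfl, rfl⟩ <;>
            simp only [Finset.mem_union] at hp hq <;> tauto
        · have f3 := a5.mem_iff hpq f2
          simp only [Finset.mem_union] at hp hq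
          tauto
      have hAB : A \ B = A := by
        refine IsCut.eq_of_notMem hG (IsCut.of_mem (a := u) (by simp [*]) (b := c) (by simp [*])
          fun p q hp hq hpq => ?_) hA (c := c) (by simp [*]) hc
        by_contra hne
        have f1 := hA.mem_iff hpq hne
        by_cases f2 : s(p, q) = s(c, b)
        · rcases Sym2.eq_iff.1 f2 with ⟨rfl, rfl⟩ | ⟨rfl, rfl⟩ <;>
            simp only [Finset.mem_sdiff] at hp hq <;> tauto
        · have f3 := a4.mem_iff hpq f2
          simp only [Finset.mem_sdiff] at hp hq
          tauto
      refine Or.inr ⟨hu, Finset.union_eq_left.1 hXA, Finset.sdiff_eq_self_iff_disjoint.1 hAB,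
        hS.isCut_switchGraph (a := u) (d := c) (by simp [*]) (by simp [*])
        (fun p q hpq f1 f2 f3 => ?_) (by simp [*]) (by simp [*])⟩
      simp only [Finset.mem_sdiff, Finset.mem_union]
      rw [hA.mem_iff hpq f3, a4.mem_iff hpq f1, a5.mem_iff hpq f2]
    · obtain ⟨y, hy⟩ := hA.1
      refine Or.inl ⟨hu, hS.isCut_switchGraph hy hc (fun p q hpq _ _ f3 => hA.mem_iff hpq f3)
        (fun _ => by tauto) fun _ => by tauto⟩

lemma steinerWiener_le (h : Switchable G c u b x B X) (hG : G.IsTree) {k : ℕ} (hk : 1 ≤ k)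
    {B₁ B₂ : Finset V} {b₂ : V} (hB₂ : IsCut G B₂ s(c, b₂)) (hc : c ∉ B₂) (hu : u ∈ B₂)
    (h₁₂ : Disjoint B₁ B₂) (h₁ : Disjoint B₁ B) (hXB : #X ≤ #B) (h₂₁ : #B₂ ≤ #B₁) :
    steinerWiener G k ≤ steinerWiener (switchGraph G c u b x) k := by
  refine steinerWiener_le_of_equiv hG (h.isTree_switchGraph hG) hk rfl h.edgeEquiv fun e => ?_
  obtain ⟨A, hA, hcA⟩ := exists_isCut_notMem hG c e.2
  rcases h.exists_isCut hG.connected hA hcA with ⟨-, hA'⟩ | ⟨huA, hXA, hAB, hA'⟩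
  · exact ⟨A, A, hA, hA', Or.inl rfl⟩
  · refine ⟨A, _, hA, hA', Or.inr ?_⟩
    have h1 : #((A ∪ B) \ X) = #A + #B - #X := by
      rw [Finset.card_sdiff_of_subset (hXA.trans Finset.subset_union_left),
        Finset.card_union_of_disjoint hAB]
    have h2 : A ⊆ B₂ := (hA.subset_or_disjoint hG.connected hB₂ hcA hc).resolve_right fun hd =>
      Finset.disjoint_left.1 hd huA hu
    have h3 : Disjoint B₁ ((A ∪ B) \ X) := Disjoint.mono_right Finset.sdiff_subset
      (Finset.disjoint_union_right.2 ⟨h₁₂.mono_right h2, h₁⟩)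
    have h4 := Finset.card_union_of_disjoint h3 ▸ Finset.card_le_univ (B₁ ∪ ((A ∪ B) \ X))
    have h5 := Finset.card_le_card h2
    omega

end Switchable

/-- An edge is internal if it separates two branch vertices. -/
def Internal (G : SimpleGraph V) (e : Sym2 V) : Prop :=
  ∃ A, IsCut G A e ∧ (∃ x ∈ A, IsBranchV G x) ∧ ∃ y, y ∉ A ∧ IsBranchV G y

lemma Internal.of_isCut (hG : G.Connected) {e : Sym2 V} (h : Internal G e) {A : Finset V}
    (hA : IsCut G A e) : (∃ x ∈ A, IsBranchV G x) ∧ ∃ y, y ∉ A ∧ IsBranchV G y := by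
  obtain ⟨A', hA', h1, h2⟩ := h
  rcases hA.eq_or_eq_compl hG hA' with rfl | rfl
  · exact ⟨h1, h2⟩
  · obtain ⟨x, hx, hx'⟩ := h1
    obtain ⟨y, hy, hy'⟩ := h2
    exact ⟨⟨y, by simpa using hy, hy'⟩, x, by simpa using hx, hx'⟩

lemma Internal.of_edgeLink (hG : G.IsTree) {e f : G.edgeSet} (h : EdgeLink G e f)
    (he : Internal G e) : Internal G f := by
  by_cases hef : e = f
  · exact hef ▸ he
  obtain ⟨v, hv, hve, hvf⟩ := h
  obtain ⟨A, hA, hvA⟩ := exists_isCut_notMem hG v e.2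
  obtain ⟨⟨p, hp, hp'⟩, q, hq, hq'⟩ := he.of_isCut hG.connected hA
  have hqv : q ≠ v := by
    rintro rfl
    unfold IsBranchV at hq'
    omega
  refine ⟨insert v A, IsCut.of_mem (Finset.mem_insert_self _ _) (b := q) (by simp [hqv, hq]) ?_,
    ⟨p, by simp [hp], hp'⟩, q, by simp [hqv, hq], hq'⟩
  intro r s hr hs hrs
  rw [Finset.mem_insert, not_or] at hs
  rcases Finset.mem_insert.1 hr with rfl | hr
  · have := eq_or_eq_of_degN_le_two hv.le hve hvf (g := ⟨s(r, s), hrs⟩) (by simp) hef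
    rcases this with h1 | h1
    · have h2 := congrArg Subtype.val h1
      simp only at h2
      rw [← h2] at hA
      exact absurd hA (fun hA => hA.not_mem_iff hG.connected (by tauto))
    · exact congrArg Subtype.val h1
  · have h1 := hA.2.2 r s hr hs.2 hrs
    rw [← h1] at hve
    rcases Sym2.mem_iff.1 hve with rfl | rfl
    · exact absurd hr hvA
    · exact absurd rfl hs.1

lemma internal_iff_of_eqvGen (hG : G.IsTree) {e f : G.edgeSet}
    (h : Relation.EqvGen (EdgeLink G) e f) : Internal G e ↔ Internal G f := by
  induction h with
  | rel e f h =>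
    have h' : EdgeLink G f e := h.imp fun v hv => ⟨hv.1, hv.2.2, hv.2.1⟩
    exact ⟨.of_edgeLink hG h, .of_edgeLink hG h'⟩
  | refl => rfl
  | symm _ _ _ ih => exact ih.symm
  | trans _ _ _ _ _ ih1 ih2 => exact ih1.trans ih2

lemma not_internal_of_isLeafV (hG : G.IsTree) {e : Sym2 V} {v : V} (hv : IsLeafV G v)
    (he : e ∈ G.edgeSet) (hve : v ∈ e) : ¬ Internal G e := by
  intro h
  obtain ⟨w, rfl⟩ := hve
  have hcut : IsCut G {v} s(v, w) := by
    refine IsCut.of_mem (a := v) (b := w) (by simp) (by simpa using he.ne') ?_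
    intro p q hp hq hpq
    obtain rfl := Finset.mem_singleton.1 hp
    obtain ⟨z, hz⟩ := Set.ncard_eq_one.1 hv
    have h1 : q ∈ G.neighborSet p := hpq
    have h2 : w ∈ G.neighborSet p := he
    rw [hz] at h1 h2
    rw [Set.mem_singleton_iff.1 h1, Set.mem_singleton_iff.1 h2]
  obtain ⟨⟨p, hp, hp'⟩, -⟩ := h.of_isCut hG.connected hcut
  obtain rfl := Finset.mem_singleton.1 hp
  unfold IsBranchV at hp'
  unfold IsLeafV at hv
  omega

lemma Switchable.internal_edgeEquiv_iff {c u b x : V} {B X : Finset V}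
    (h : Switchable G c u b x B X) (hG : G.IsTree) (hc : IsBranchV G c) (hu : IsBranchV G u)
    (e : G.edgeSet) :
    Internal (switchGraph G c u b x) (h.edgeEquiv e) ↔ Internal G e := by
  have hT := h.isTree_switchGraph hG
  have hbr : ∀ v, IsBranchV (switchGraph G c u b x) v ↔ IsBranchV G v := fun v => by
    unfold IsBranchV
    rw [h.degN_switchGraph]
  obtain ⟨A, hA, hcA⟩ := exists_isCut_notMem hG c e.2
  have key : ∀ A', IsCut (switchGraph G c u b x) A' (h.edgeEquiv e) → c ∉ A' →
      ((∃ y ∈ A', IsBranchV G y) ↔ ∃ y ∈ A, IsBranchV G y) →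
      (Internal (switchGraph G c u b x) (h.edgeEquiv e) ↔ Internal G e) := by
    intro A' hA' hc' hiff
    constructor
    · intro hi
      obtain ⟨⟨y, hy, hy'⟩, -⟩ := hi.of_isCut hT.connected hA'
      exact ⟨A, hA, hiff.1 ⟨y, hy, (hbr y).1 hy'⟩, c, hcA, hc⟩
    · intro hi
      obtain ⟨y, hy, hy'⟩ := hiff.2 (hi.of_isCut hG.connected hA).1
      exact ⟨A', hA', ⟨y, hy, (hbr y).2 hy'⟩, c, hc', (hbr c).2 hc⟩
  rcases h.exists_isCut hG.connected hA hcA with ⟨-, hA'⟩ | ⟨huA, hXA, hAB, hA'⟩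
  · exact key A hA' hcA Iff.rfl
  · refine key _ hA' (by simp [hcA, h.c_notMem_B]) ⟨fun _ => ⟨u, huA, hu⟩, fun _ => ⟨u, ?_, hu⟩⟩
    simp [huA, h.u_notMem_X]

/-- The number of internal edges at `v`. -/
noncomputable def internalDeg (G : SimpleGraph V) (v : V) : ℕ :=
  #{e : G.edgeSet | Internal G e ∧ v ∈ e.1}

/-- The total excess of the internal degrees over `2`. -/
noncomputable def internalExcess (G : SimpleGraph V) : ℕ := ∑ v, (internalDeg G v - 2)

lemma internalDeg_le_degN (v : V) : internalDeg G v ≤ degN G v := by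
  rw [degN_eq_card_edges]
  exact Finset.card_le_card fun e he => by
    simp only [Finset.mem_filter] at he ⊢
    exact ⟨he.1, he.2.2⟩

lemma Switchable.internalExcess_lt {c u b x : V} {B X : Finset V}
    (h : Switchable G c u b x B X) (hG : G.IsTree) (hu : IsBranchV G u)
    (hcb : Internal G s(c, b)) (hux : ¬ Internal G s(u, x)) (hc3 : 3 ≤ internalDeg G c)
    (hu1 : internalDeg G u ≤ 1) : internalExcess (switchGraph G c u b x) < internalExcess G := by
  have hc : IsBranchV G c := hc3.trans (internalDeg_le_degN c)
  have hdeg : ∀ v, internalDeg (switchGraph G c u b x) v =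
      #{e : G.edgeSet | Internal G e ∧ v ∈ (h.edgeEquiv e).1} := by
    intro v
    refine (Finset.card_equiv h.edgeEquiv fun e => ?_).symm
    simp only [Finset.mem_filter, Finset.mem_univ, true_and]
    rw [h.internal_edgeEquiv_iff hG hc hu]
  have h1 : internalDeg (switchGraph G c u b x) c < internalDeg G c := by
    rw [hdeg]
    refine Finset.card_lt_card (Finset.ssubset_iff_subset_ne.2 ⟨fun e he => ?_, fun heq => ?_⟩)
    · simp only [Finset.mem_filter, Finset.mem_univ, true_and] at he ⊢
      refine ⟨he.1, ?_⟩
      rcases h.edgeEquiv_apply e with ⟨h1, h2⟩ | ⟨h1, h2⟩ | ⟨-, -, h2⟩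
      · simp [h1]
      · exact absurd he.1 (h1 ▸ hux)
      · exact h2 ▸ he.2
    · have h1 := (Finset.ext_iff.1 heq ⟨s(c, b), h.adj_cb⟩).2 (by simp [hcb])
      simp only [Finset.mem_filter, Finset.mem_univ, true_and] at h1
      have hd := h.distinct
      rcases h.edgeEquiv_apply ⟨s(c, b), h.adj_cb⟩ with ⟨-, h2⟩ | ⟨h2, -⟩ | ⟨h2, -⟩
      · rw [h2] at h1
        simp [hd.1, h.ne] at h1
      · exact hux (h2 ▸ hcb)
      · exact h2 rfl
  have h2 : internalDeg (switchGraph G c u b x) u ≤ 2 := by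
    rw [hdeg]
    have hsub : ({e : G.edgeSet | Internal G e ∧ u ∈ (h.edgeEquiv e).1} : Finset G.edgeSet) ⊆
        insert ⟨s(c, b), h.adj_cb⟩
          ({e : G.edgeSet | Internal G e ∧ u ∈ e.1} : Finset G.edgeSet) := by
      intro e he
      simp only [Finset.mem_filter, Finset.mem_univ, true_and, Finset.mem_insert] at he ⊢
      rcases h.edgeEquiv_apply e with ⟨h1, h2⟩ | ⟨h1, h2⟩ | ⟨-, -, h2⟩
      · exact Or.inl (Subtype.ext h1)
      · exact absurd he.1 (h1 ▸ hux)
      · exact Or.inr (h2 ▸ he)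
    exact (Finset.card_le_card hsub).trans ((Finset.card_insert_le _ _).trans
      (Nat.succ_le_succ hu1))
  refine Finset.sum_lt_sum (fun v _ => ?_) ⟨c, Finset.mem_univ c, by omega⟩
  by_cases hvc : v = c
  · subst hvc
    omega
  by_cases hvu : v = u
  · subst hvu
    omega
  have h3 : internalDeg (switchGraph G c u b x) v = internalDeg G v := by
    rw [hdeg]
    unfold internalDeg
    congr 1
    ext e
    simp only [Finset.mem_filter, Finset.mem_univ, true_and, h.mem_edgeEquiv_iff e hvc hvu]
  rw [h3]

lemma IsCut.right_mem (hG : G.Connected) {A : Finset V} {c a : V} (hA : IsCut G A s(c, a))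
    (hc : c ∉ A) : a ∈ A := by
  have := hA.not_mem_iff hG
  tauto

lemma IsCut.disjoint (hG : G.Connected) {A B : Finset V} {c a b : V} (hca : G.Adj c a)
    (hA : IsCut G A s(c, a)) (hB : IsCut G B s(c, b)) (hab : a ≠ b) (hcA : c ∉ A)
    (hcB : c ∉ B) : Disjoint A B := by
  refine (hA.subset_or_disjoint hG hB hcA hcB).resolve_left fun h => hcB ?_
  exact (hB.mem_iff hca fun h' => hab (Sym2.congr_right.1 h')).2 (h (hA.right_mem hG hcA))

lemma exists_isCut_notMem_of_two_le (hG : G.IsTree) (c : V) {u : V} (hu : 2 ≤ degN G u) :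
    ∃ x X, G.Adj u x ∧ IsCut G X s(u, x) ∧ u ∉ X ∧ c ∉ X := by
  obtain ⟨x, hx, y, hy, hxy⟩ := (Set.one_lt_ncard (Set.toFinite _)).1 hu
  obtain ⟨X, hX, -, huX⟩ := exists_isCut_of_adj hG hx
  obtain ⟨Y, hY, -, huY⟩ := exists_isCut_of_adj hG hy
  by_cases hc : c ∈ X
  · exact ⟨y, Y, hy, hY, huY, fun h => Finset.disjoint_left.1
      (hX.disjoint hG.connected hx hY hxy huX huY) hc h⟩
  · exact ⟨x, X, hx, hX, huX, hc⟩

lemma IsCut.dist_lt (hG : G.Connected) {X : Finset V} {u x c y : V} (hX : IsCut G X s(u, x))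
    (hu : u ∉ X) (hc : c ∉ X) (hy : y ∈ X) : G.dist c u < G.dist c y := by
  obtain ⟨w, hw⟩ := hG.exists_walk_length_eq_dist c y
  have he : s(u, x) ∈ w.edges := by
    by_contra he
    exact hc ((hX.mem_iff_of_notMem_edges w he).2 hy)
  have hmem : u ∈ w.support := w.fst_mem_support_of_mem_edges he
  rw [← hw]
  exact (dist_le (w.takeUntil u hmem)).trans_lt
    (w.length_takeUntil_lt_length hmem fun h => hu (h ▸ hy))

/-- A vertex with three internal edges allows a switch which does not decrease the Steiner Wiener
index and decreases the excess of the internal degrees. -/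
lemma exists_internalExcess_lt (hG : G.IsTree) {k : ℕ} (hk : 1 ≤ k) {c : V}
    (hc3 : 3 ≤ internalDeg G c) : ∃ G' : SimpleGraph V, G'.IsTree ∧
      segmentMultiset G' = segmentMultiset G ∧ steinerWiener G k ≤ steinerWiener G' k ∧
      internalExcess G' < internalExcess G ∧ ∃ v, IsBranchV G' v := by
  have hc : IsBranchV G c := hc3.trans (internalDeg_le_degN c)
  choose A hA hcA using fun e : G.edgeSet => exists_isCut_notMem hG c e.2
  set I : Finset G.edgeSet := {e : G.edgeSet | Internal G e ∧ c ∈ e.1} with hI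
  have hI3 : 3 ≤ #I := hc3
  have hIne : I.Nonempty := Finset.card_pos.1 (by omega)
  have hdisj : ∀ e f : G.edgeSet, c ∈ e.1 → c ∈ f.1 → e ≠ f → Disjoint (A e) (A f) := by
    rintro ⟨e, he⟩ ⟨f, hf⟩ ⟨p, rfl⟩ ⟨q, rfl⟩ hef
    exact (hA _).disjoint hG.connected he (hA _) (fun h => hef (by subst h; rfl)) (hcA _) (hcA _)
  obtain ⟨e₁, he₁, hmax₁⟩ := Finset.exists_max_image {e : G.edgeSet | c ∈ e.1} (fun e => #(A e))
    (hIne.mono fun e he => by simp_all)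
  obtain ⟨e₂, e₃, he₂, he₃, h₂₃, hle⟩ : ∃ e₂ e₃, e₂ ∈ I.erase e₁ ∧ e₃ ∈ I.erase e₁ ∧ e₂ ≠ e₃ ∧
      #(A e₂) ≤ #(A e₃) := by
    have h1 : 1 < #(I.erase e₁) := by
      have := Finset.pred_card_le_card_erase (s := I) (a := e₁)
      omega
    obtain ⟨p, hp, q, hq, hpq⟩ := Finset.one_lt_card.1 h1
    rcases le_total #(A p) #(A q) with h | h
    · exact ⟨p, q, hp, hq, hpq, h⟩
    · exact ⟨q, p, hq, hp, hpq.symm, h⟩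
  simp only [hI, Finset.mem_erase, Finset.mem_filter, Finset.mem_univ, true_and]
    at he₁ hmax₁ he₂ he₃
  obtain ⟨h₂₁, hi₂, hc₂⟩ := he₂
  obtain ⟨h₃₁, hi₃, hc₃⟩ := he₃
  have hd₁₂ := hdisj e₁ e₂ he₁ hc₂ h₂₁.symm
  have hd₁₃ := hdisj e₁ e₃ he₁ hc₃ h₃₁.symm
  have hd₂₃ := hdisj e₂ e₃ hc₂ hc₃ h₂₃
  have hA₂ := hA e₂
  have hA₃ := hA e₃
  have hcA₂ := hcA e₂
  have hcA₃ := hcA e₃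
  have hle₁ := hmax₁ e₂ hc₂
  obtain ⟨b₂, hb₂⟩ := hc₂
  obtain ⟨b, hb⟩ := hc₃
  have hcb : G.Adj c b := by
    rw [← mem_edgeSet, ← hb]
    exact e₃.2
  rw [hb] at hA₃ hi₃
  obtain ⟨⟨z, hz, hz'⟩, -⟩ := hi₂.of_isCut hG.connected hA₂
  rw [hb₂] at hA₂
  obtain ⟨u, hu, hmax⟩ := Finset.exists_max_image {v ∈ A e₂ | IsBranchV G v} (fun v => G.dist c v)
    ⟨z, by simp [hz, hz']⟩
  simp only [Finset.mem_filter, and_imp] at hu hmax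
  obtain ⟨huA, hu⟩ := hu
  have hcu : c ≠ u := fun h => hcA₂ (h ▸ huA)
  have hfar : ∀ y Y, G.Adj u y → IsCut G Y s(u, y) → u ∉ Y → c ∉ Y →
      Y ⊆ A e₂ ∧ ∀ v ∈ Y, ¬ IsBranchV G v := by
    intro y Y hy hY huY hcY
    have hyY := hY.right_mem hG.connected huY
    have hyA : y ∈ A e₂ := (hA₂.mem_iff hy (fun h => by
      rcases Sym2.eq_iff.1 h with ⟨h1, -⟩ | ⟨-, h1⟩
      · exact hcu h1.symm
      · exact hcY (h1 ▸ hyY))).1 huA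
    have hsub := (hY.subset_or_disjoint hG.connected hA₂ hcY hcA₂).resolve_right fun h =>
      Finset.disjoint_left.1 h hyY hyA
    refine ⟨hsub, fun v hv hbv => ?_⟩
    have h1 := hmax v (hsub hv) hbv
    have h2 := hY.dist_lt hG.connected huY hcY hv
    omega
  obtain ⟨x, X, hux, hX, huX, hcX⟩ := exists_isCut_notMem_of_two_le hG c
    (le_trans (by norm_num) hu : 2 ≤ degN G u)
  obtain ⟨hXA, hXbr⟩ := hfar x X hux hX huX hcX
  have hxX := hX.right_mem hG.connected huX
  have hbA := hA₃.right_mem hG.connected hcA₃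
  have hS : Switchable G c u b x (A e₃) X :=
    ⟨hcb, hux, hcu, hA₃, hX, hbA, hcA₃, fun h => Finset.disjoint_left.1 hd₂₃ huA h,
      fun h => Finset.disjoint_left.1 hd₂₃ (hXA hxX) h, hxX, hcX, huX,
      fun h => Finset.disjoint_left.1 hd₂₃ (hXA h) hbA⟩
  have hnot : ∀ y Y, G.Adj u y → IsCut G Y s(u, y) → u ∉ Y → c ∉ Y → ¬ Internal G s(u, y) := by
    intro y Y hy hY huY hcY hi
    obtain ⟨⟨v, hv, hv'⟩, -⟩ := hi.of_isCut hG.connected hY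
    exact (hfar y Y hy hY huY hcY).2 v hv hv'
  have hu1 : internalDeg G u ≤ 1 := by
    refine Finset.card_le_one.2 fun e he f hf => ?_
    simp only [Finset.mem_filter, Finset.mem_univ, true_and] at he hf
    obtain ⟨e, he'⟩ := e
    obtain ⟨f, hf'⟩ := f
    obtain ⟨hie, p, rfl⟩ := he
    obtain ⟨hif, q, rfl⟩ := hf
    obtain ⟨P, hP, -, huP⟩ := exists_isCut_of_adj hG he'
    obtain ⟨Q, hQ, -, huQ⟩ := exists_isCut_of_adj hG hf'
    by_contra hne
    have hPQ := hP.disjoint hG.connected he' hQ (fun h => hne (by subst h; rfl)) huP huQ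
    exact Finset.disjoint_left.1 hPQ (by_contra fun h => hnot p P he' hP huP h hie)
      (by_contra fun h => hnot q Q hf' hQ huQ h hif)
  refine ⟨switchGraph G c u b x, hS.isTree_switchGraph hG, hS.segmentMultiset_switchGraph hG
    (degN_ne_two_of_or (Or.inr hc)) (degN_ne_two_of_or (Or.inr hu)),
    hS.steinerWiener_le hG hk hA₂ hcA₂ huA hd₁₂ hd₁₃ ((Finset.card_le_card hXA).trans hle) hle₁,
    hS.internalExcess_lt hG hu hi₃ (hnot x X hux hX huX hcX) hc3 hu1, c, ?_⟩
  unfold IsBranchV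
  rw [hS.degN_switchGraph]
  exact hc

lemma exists_internalDeg_le_two (hG : G.IsTree) {k : ℕ} (hk : 1 ≤ k) (hbr : ∃ v, IsBranchV G v) :
    ∃ G' : SimpleGraph V, G'.IsTree ∧ segmentMultiset G' = segmentMultiset G ∧
      steinerWiener G k ≤ steinerWiener G' k ∧ (∃ v, IsBranchV G' v) ∧
      ∀ v, internalDeg G' v ≤ 2 := by
  induction hn : internalExcess G using Nat.strong_induction_on generalizing G with
  | _ n ih =>
    by_cases h : ∀ v, internalDeg G v ≤ 2
    · exact ⟨G, hG, rfl, le_rfl, hbr, h⟩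
    · push Not at h
      obtain ⟨c, hc⟩ := h
      obtain ⟨G₁, h1, h2, h3, h4, h5⟩ := exists_internalExcess_lt hG hk hc
      obtain ⟨G₂, k1, k2, k3, k4, k5⟩ := ih _ (hn ▸ h4) h1 h5 rfl
      exact ⟨G₂, k1, k2.trans h2, h3.trans k3, k4, k5⟩

omit [Fintype V] in
lemma isPathGraph_of_connected [Finite V] (hG : G.Connected)
    (h3 : ∀ v p q r, G.Adj v p → G.Adj v q → G.Adj v r → p = q ∨ p = r ∨ q = r) :
    IsPathGraph G := by
  have := Fintype.ofFinite V
  have hne := hG.nonempty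
  set L : Set ℕ := {n | ∃ (u v : V) (w : G.Walk u v), w.IsPath ∧ w.length = n} with hL
  have hbdd : BddAbove L := ⟨Fintype.card V, by
    rintro _ ⟨u, v, w, hw, rfl⟩
    exact hw.length_lt.le⟩
  obtain ⟨u, v, w, hw, hlen⟩ : sSup L ∈ L := Nat.sSup_mem
    ⟨0, hne.some, hne.some, Walk.nil, Walk.IsPath.nil, rfl⟩ hbdd
  have hmax : ∀ (a b : V) (w' : G.Walk a b), w'.IsPath → w'.length ≤ w.length :=
    fun a b w' hw' => hlen ▸ le_csSup hbdd ⟨a, b, w', hw', rfl⟩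
  refine ⟨u, v, w, hw, fun x => ?_⟩
  by_contra hx
  obtain ⟨p⟩ := hG.preconnected u x
  obtain ⟨d, -, h1, h2⟩ := p.exists_boundary_dart {y | y ∈ w.support} w.start_mem_support hx
  obtain ⟨⟨y, z⟩, hyz⟩ := d
  simp only [Set.mem_ofPred_eq] at h1 h2
  by_cases hyu : y = u
  · subst hyu
    have := hmax _ _ (Walk.cons hyz.symm w) (hw.cons h2)
    simp at this
  by_cases hyv : y = v
  · subst hyv
    have := hmax _ _ (w.concat hyz) (hw.concat h2 hyz)
    simp at this
  obtain ⟨r, s, hrs, hr, hs⟩ := exists_two_edges_of_mem_support hw h1 hyu hyv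
  rcases h3 y r s z (w.edges_subset_edgeSet hr) (w.edges_subset_edgeSet hs) hyz with h | h | h
  · exact hrs h
  · exact h2 (h ▸ w.snd_mem_support_of_mem_edges hr)
  · exact h2 (h ▸ w.snd_mem_support_of_mem_edges hs)

lemma notMem_pendantSegmentVertices_iff (hG : G.IsTree) (hbr : ∃ v, IsBranchV G v) {x : V} :
    x ∉ pendantSegmentVertices G ↔ IsBranchV G x ∨ ∃ y, G.Adj x y ∧ Internal G s(x, y) := by
  constructor
  · intro hx
    by_contra! h
    obtain ⟨h1, h2⟩ := h
    obtain ⟨v, hv⟩ := hbr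
    have hxv : x ≠ v := fun h => h1 (h ▸ hv)
    have : Nontrivial V := ⟨x, v, hxv⟩
    obtain ⟨y, hxy⟩ := hG.connected.preconnected.exists_adj_of_nontrivial x
    obtain ⟨a, b, w, hs, hw, he⟩ := exists_isSegment_of_mem_edgeSet hG ⟨s(x, y), hxy⟩
    have hxw := w.fst_mem_support_of_mem_edges he
    by_cases ha : IsLeafV G a
    · exact hx ⟨a, b, w, hs, ha, hw.1, hw.2, hxw, h1⟩
    by_cases hb : IsLeafV G b
    · exact hx ⟨b, a, w.reverse,
        ⟨hs.1.symm, hs.2.2.1, hs.2.1, w.reverse, hw.reverse.1, hw.reverse.2⟩, hb, hw.reverse.1, hw.reverse.2, by simpa using hxw, h1⟩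
    refine h2 y hxy ?_
    have ha' := hs.2.1.resolve_left ha
    have hb' := hs.2.2.1.resolve_left hb
    obtain ⟨A, hA, haA⟩ := exists_isCut_notMem hG a (e := s(x, y)) hxy
    have := hA.not_mem_iff_of_mem_edges hG.connected w hw.1.isTrail he
    exact ⟨A, hA, ⟨b, by tauto, hb'⟩, a, haA, ha'⟩
  · rintro h ⟨u, v, w, hs, hu, hw, hw', hx, hxb⟩
    obtain ⟨y, hxy, hi⟩ := h.resolve_left hxb
    by_cases hxu : x = u
    · exact not_internal_of_isLeafV hG (hxu ▸ hu) (e := s(x, y)) hxy (by simp) hi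
    by_cases hxv : x = v
    · refine not_internal_of_isLeafV (v := x) hG ?_ (e := s(x, y)) hxy (by simp) hi
      exact hs.2.2.1.elim (fun h => hxv ▸ h) fun h => absurd (hxv ▸ h) hxb
    obtain ⟨p, -, -, hp, -⟩ := exists_two_edges_of_mem_support hw hx hxu hxv
    have h1 := Walk.mk_start_snd_mem_edges (Walk.not_nil_of_ne (p := w) hs.1)
    have h2 := IsSegmentPath.eqvGen (w := w) ⟨hw, hw'⟩ ⟨_, w.edges_subset_edgeSet hp⟩
      ⟨_, w.edges_subset_edgeSet h1⟩ hp h1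
    have h3 : EdgeLink G ⟨s(x, y), hxy⟩ ⟨_, w.edges_subset_edgeSet hp⟩ :=
      ⟨x, hw' x hx hxu hxv, by simp, by simp⟩
    have h4 := (internal_iff_of_eqvGen hG (.trans _ _ _ (.rel _ _ h3) h2)).1 hi
    exact not_internal_of_isLeafV hG hu (w.edges_subset_edgeSet h1) (by simp) h4

lemma IsCut.exists_isBranchV (hG : G.Connected) {A : Finset V} {e : Sym2 V} (hA : IsCut G A e)
    {p : V} (hpA : p ∈ A) (hp : IsBranchV G p ∨ ∃ q, G.Adj p q ∧ Internal G s(p, q)) :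
    ∃ v ∈ A, IsBranchV G v := by
  rcases hp with hp | ⟨q, -, hQ⟩
  · exact ⟨p, hpA, hp⟩
  obtain ⟨Q, hQ, hpQ, h1, h2⟩ : ∃ Q, IsCut G Q s(p, q) ∧ p ∉ Q ∧ (∃ x ∈ Q, IsBranchV G x) ∧
      ∃ y, y ∉ Q ∧ IsBranchV G y := by
    obtain ⟨Q, hQ', h1, y, h2, h3⟩ := hQ
    by_cases hp : p ∈ Q
    · obtain ⟨x, h4, h5⟩ := h1
      exact ⟨Qᶜ, hQ'.compl, by simpa using hp, ⟨y, by simpa using h2, h3⟩, x, by simpa using h4, h5⟩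
    · exact ⟨Q, hQ', hp, h1, y, h2, h3⟩
  rcases hA.compl.subset_or_disjoint hG hQ (by simpa using hpA) hpQ with h | h
  · obtain ⟨y, hy, hy'⟩ := h2
    exact ⟨y, by_contra fun hyA => hy (h (by simpa using hyA)), hy'⟩
  · obtain ⟨y, hy, hy'⟩ := h1
    exact ⟨y, by_contra fun hyA => Finset.disjoint_left.1 h (by simpa using hyA) hy, hy'⟩

lemma isQuasiCaterpillar_of_internalDeg_le_two (hG : G.IsTree) (hbr : ∃ v, IsBranchV G v)
    (h2 : ∀ v, internalDeg G v ≤ 2) : IsQuasiCaterpillar G := by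
  refine ⟨hG, ?_⟩
  have hK : ∀ x, x ∈ (pendantSegmentVertices G)ᶜ ↔ _ := fun x =>
    notMem_pendantSegmentVertices_iff hG hbr
  have h_internal : ∀ {p q : V} (w : G.Walk p q), w.IsPath → p ∈ (pendantSegmentVertices G)ᶜ →
      q ∈ (pendantSegmentVertices G)ᶜ → ∀ e ∈ w.edges, Internal G e := by
    intro p q w hw hp hq e he
    obtain ⟨A, hA, hpA⟩ := exists_isCut_notMem hG p (w.edges_subset_edgeSet he)
    have hqA := hA.not_mem_iff_of_mem_edges hG.connected w hw.isTrail he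
    obtain ⟨y, hy, hy'⟩ := hA.compl.exists_isBranchV hG.connected
      (by simpa using hpA) ((hK p).1 hp)
    exact ⟨A, hA, hA.exists_isBranchV hG.connected (by tauto) ((hK q).1 hq), y,
      by simpa using hy, hy'⟩
  refine isPathGraph_of_connected ?_ ?_
  · obtain ⟨v, hv⟩ := hbr
    have : Nonempty ↑(pendantSegmentVertices G)ᶜ := ⟨v, (hK v).2 (Or.inl hv)⟩
    refine ⟨fun p q => ?_⟩
    obtain ⟨w, hw⟩ := (hG.connected.preconnected p.1 q.1).exists_isPath
    refine ⟨w.induce _ fun x hx => (hK x).2 ?_⟩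
    by_cases hxq : x = q.1
    · exact hxq ▸ (hK _).1 q.2
    have he := Walk.mk_start_snd_mem_edges (Walk.not_nil_of_ne (p := w.dropUntil x hx) hxq)
    have he' := w.edges_dropUntil_subset_edges hx he
    exact Or.inr ⟨_, w.edges_subset_edgeSet he', h_internal w hw p.2 q.2 _ he'⟩
  · intro v p q r hp hq hr
    by_contra! hne
    obtain ⟨h1, h3, h4⟩ := hne
    have hsub : ({⟨s(v.1, p.1), hp⟩, ⟨s(v.1, q.1), hq⟩, ⟨s(v.1, r.1), hr⟩} : Finset G.edgeSet) ⊆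
        ({e : G.edgeSet | Internal G e ∧ v.1 ∈ e.1} : Finset G.edgeSet) := by
      have hi : ∀ y : ↑(pendantSegmentVertices G)ᶜ, G.Adj v.1 y.1 → Internal G s(v.1, y.1) :=
        fun y hy => h_internal (Walk.cons hy Walk.nil) (by simpa using hy.ne) v.2 y.2 _ (by simp)
      intro e he
      simp only [Finset.mem_insert, Finset.mem_singleton] at he
      rcases he with rfl | rfl | rfl <;> simp [hi _ hp, hi _ hq, hi _ hr]
    have h5 := Finset.card_le_card hsub
    rw [Finset.card_eq_three.2 ⟨_, _, _, ?_, ?_, ?_, rfl⟩] at h5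
    · exact absurd (h5.trans (h2 v)) (by norm_num)
    all_goals
      intro h
      have := Sym2.congr_right.1 (congrArg Subtype.val h)
      have := Subtype.ext this
      contradiction

lemma exists_isBranchV (hG : G.IsTree) (h : 2 ≤ Multiset.card (segmentMultiset G)) :
    ∃ v, IsBranchV G v := by
  by_contra! hbr
  unfold IsBranchV at hbr
  have hlink : ∀ {p : V} {f g : G.edgeSet}, p ∈ f.1 → p ∈ g.1 →
      Relation.EqvGen (EdgeLink G) f g := by
    intro p f g hf hg
    by_cases hfg : f = g
    · exact hfg ▸ .refl _
    refine .rel _ _ ⟨p, ?_, hf, hg⟩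
    have h1 : 1 < #{e : G.edgeSet | p ∈ e.1} :=
      Finset.one_lt_card.2 ⟨f, by simpa using hf, g, by simpa using hg, hfg⟩
    rw [← degN_eq_card_edges] at h1
    have := hbr p
    omega
  rw [segmentMultiset_eq hG, Multiset.card_map, Finset.card_val] at h
  obtain ⟨C, hC, D, hD, hCD⟩ := Finset.one_lt_card.1 h
  obtain ⟨e, -, rfl⟩ := Finset.mem_image.1 hC
  obtain ⟨f, -, rfl⟩ := Finset.mem_image.1 hD
  refine hCD (edgeClass_eq_iff.2 ?_)
  have huniv := eq_empty_or_univ_of_not_adj hG.connected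
    (univ.filter fun v => ∃ g ∈ edgeClass G e, v ∈ g.1) (by
      intro p q hp hq hpq
      simp only [Finset.mem_filter, Finset.mem_univ, true_and, mem_edgeClass] at hp hq
      obtain ⟨g, hg, hpg⟩ := hp
      exact hq ⟨⟨s(p, q), hpq⟩, .trans _ _ _ hg (hlink hpg (by simp)), by simp⟩)
  obtain ⟨⟨p, q⟩, he⟩ := e
  obtain ⟨⟨r, s⟩, hf⟩ := f
  rcases huniv with h' | h'
  · have := (Finset.ext_iff.1 h' p).1 (by
      simp only [Finset.mem_filter, Finset.mem_univ, true_and, mem_edgeClass]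
      exact ⟨_, .refl _, Sym2.mem_mk_left p q⟩)
    simp at this
  · have := (Finset.ext_iff.1 h' r).2 (Finset.mem_univ r)
    simp only [Finset.mem_filter, Finset.mem_univ, true_and, mem_edgeClass] at this
    obtain ⟨g, hg, hrg⟩ := this
    exact .trans _ _ _ hg (hlink hrg (Sym2.mem_mk_left r s))

section Iso

variable {W : Type*} [Fintype W] {G' : SimpleGraph W}

omit [Fintype V] [Fintype W] in
lemma degN_iso (φ : G ≃g G') (v : V) : degN G' (φ v) = degN G v :=
  (Nat.card_congr (φ.mapNeighborSet v)).symm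

omit [Fintype V] [Fintype W] in
lemma apply_mem_mapEdgeSet_iff (φ : G ≃g G') (v : V) (e : G.edgeSet) :
    φ v ∈ (φ.mapEdgeSet e).1 ↔ v ∈ e.1 := by
  change φ v ∈ Sym2.map φ e.1 ↔ _
  simp

lemma segmentMultiset_iso (hG : G.IsTree) (hG' : G'.IsTree) (φ : G ≃g G') :
    segmentMultiset G = segmentMultiset G' := by
  refine segmentMultiset_congr hG hG' φ.mapEdgeSet fun e f => ?_
  refine φ.toEquiv.exists_congr fun v => ?_
  change _ ↔ degN G' (φ v) = 2 ∧ φ v ∈ _ ∧ φ v ∈ _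
  rw [degN_iso, apply_mem_mapEdgeSet_iff, apply_mem_mapEdgeSet_iff]

lemma steinerWiener_le_iso (hG : G.IsTree) (hG' : G'.IsTree) {k : ℕ} (hk : 1 ≤ k)
    (φ : G ≃g G') : steinerWiener G k ≤ steinerWiener G' k := by
  refine steinerWiener_le_of_equiv hG hG' hk (Fintype.card_congr φ.toEquiv) φ.mapEdgeSet fun e => ?_
  have : Nonempty V := hG.connected.nonempty
  obtain ⟨A, hA, -⟩ := exists_isCut_notMem hG (Classical.arbitrary V) e.2
  refine ⟨A, A.map φ.toEquiv.toEmbedding, hA, ?_, Or.inl (by simp)⟩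
  obtain ⟨a, ha⟩ := hA.1
  obtain ⟨b, hb⟩ := hA.exists_notMem
  have hmem : ∀ v, φ v ∈ A.map φ.toEquiv.toEmbedding ↔ v ∈ A := fun v => by
    rw [Finset.mem_map_equiv]
    exact iff_of_eq (congrArg (· ∈ A) (φ.toEquiv.symm_apply_apply v))
  refine IsCut.of_mem ((hmem a).2 ha) (fun h => hb ((hmem b).1 h)) fun p q hp hq hpq => ?_
  obtain ⟨p, rfl⟩ := φ.surjective p
  obtain ⟨q, rfl⟩ := φ.surjective q
  rw [hmem] at hp hq
  change _ = Sym2.map φ e.1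
  rw [← hA.2.2 p q hp hq (φ.map_adj_iff.1 hpq), Sym2.map_mk]

end Iso

lemma exists_fin_iso {n : ℕ} (hn : Fintype.card V = n) :
    ∃ H : SimpleGraph (Fin n), Nonempty (G ≃g H) :=
  ⟨_, ⟨Iso.map (Fintype.equivFinOfCardEq hn) G⟩⟩

end Cuts

/-- For every `k ≥ 2` and every segment sequence `ℓ` (with `m ≥ 3` segments)
realized by some tree, there is a quasi-caterpillar `Q` with segment sequence `ℓ` maximizing
the Steiner `k`-Wiener index among all trees with segment sequence `ℓ`. -/
theorem quasiCaterpillar_maximizes_steinerWiener (k m : ℕ) (hk : 2 ≤ k) (hm : 3 ≤ m)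
    (ℓ : Multiset ℕ) (hcard : Multiset.card ℓ = m)
    (hex : ∃ (V : Type) (_ : Fintype V) (T : SimpleGraph V),
      T.IsTree ∧ segmentMultiset T = ℓ) :
    ∃ Q : SimpleGraph (Fin (ℓ.sum + 1)), Q.IsTree ∧ IsQuasiCaterpillar Q ∧
      segmentMultiset Q = ℓ ∧
      ∀ (W : Type) [Fintype W] (T : SimpleGraph W), T.IsTree → segmentMultiset T = ℓ →
        steinerWiener T k ≤ steinerWiener Q k := by
  have hk' : 1 ≤ k := by omega
  have hfin : ∀ (W : Type) [Fintype W] (T : SimpleGraph W), T.IsTree → segmentMultiset T = ℓ →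
      ∃ H : SimpleGraph (Fin (ℓ.sum + 1)), H.IsTree ∧ segmentMultiset H = ℓ ∧
        steinerWiener T k ≤ steinerWiener H k := by
    intro W _ T hT hTℓ
    obtain ⟨H, ⟨φ⟩⟩ := exists_fin_iso (G := T) (hTℓ ▸ (sum_segmentMultiset_add_one hT).symm)
    have hH : H.IsTree := φ.isTree_iff.1 hT
    exact ⟨H, hH, (segmentMultiset_iso hT hH φ).symm.trans hTℓ, steinerWiener_le_iso hT hH hk' φ⟩
  obtain ⟨V, _, T₀, hT₀, hT₀ℓ⟩ := hex
  obtain ⟨H₀, hH₀, hH₀ℓ, -⟩ := hfin V T₀ hT₀ hT₀ℓ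
  obtain ⟨M, ⟨hM, hMℓ⟩, hmax⟩ := Set.exists_max_image
    {H : SimpleGraph (Fin (ℓ.sum + 1)) | H.IsTree ∧ segmentMultiset H = ℓ}
    (fun H => steinerWiener H k) (Set.toFinite _) ⟨H₀, hH₀, hH₀ℓ⟩
  obtain ⟨Q, hQ, hQM, hle, hbr, hdeg⟩ := exists_internalDeg_le_two hM hk'
    (exists_isBranchV hM (by rw [hMℓ]; omega))
  refine ⟨Q, hQ, isQuasiCaterpillar_of_internalDeg_le_two hQ hbr hdeg, hQM.trans hMℓ,
    fun W _ T hT hTℓ => ?_⟩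
  obtain ⟨H, hH, hHℓ, hTH⟩ := hfin W T hT hTℓ
  exact hTH.trans ((hmax H ⟨hH, hHℓ⟩).trans hle)
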